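/- arXiv:1703.07532 — 2 statements merged into one kernel-verified Lean document; each statement's English description precedes it below -/
import Mathlib

section
/- Let r ≥ 3 be an integer. If G is a connected planar graph on n vertices with minimum degree 2 that contains no r-family, then G has a matching of size at least n/(12r − 3). -/
open Set Bornology

/-- A plane embedding of a simple graph: each vertex is mapped to a point of the
plane, each edge to an injective arc joining its endpoints; arcs avoid vertices
other than their endpoints and distinct arcs meet only at common endpoints. -/
structure PlaneEmbedding {V : Type} (G : SimpleGraph V) where
  pos : V → ℝ × ℝ
  pos_inj : Function.Injective pos
  arc : G.edgeSet → Set (ℝ × ℝ)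
  arc_path : ∀ e : G.edgeSet, ∃ u v : V, (e : Sym2 V) = s(u, v) ∧
    ∃ γ : Path (pos u) (pos v), Function.Injective ⇑γ ∧ Set.range ⇑γ = arc e
  arc_avoid : ∀ (e : G.edgeSet) (w : V), pos w ∈ arc e → w ∈ (e : Sym2 V)
  arc_inter : ∀ e f : G.edgeSet, e ≠ f → ∀ x ∈ arc e ∩ arc f,
    ∃ w : V, w ∈ (e : Sym2 V) ∧ w ∈ (f : Sym2 V) ∧ x = pos w

namespace PlaneEmbedding

variable {V : Type} {G : SimpleGraph V}

/-- The image (drawing) of the plane graph in the plane. -/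
def image (P : PlaneEmbedding G) : Set (ℝ × ℝ) :=
  Set.range P.pos ∪ ⋃ e : G.edgeSet, P.arc e

/-- A face: a connected component of the complement of the image. -/
def IsFace (P : PlaneEmbedding G) (f : Set (ℝ × ℝ)) : Prop :=
  ∃ x, x ∉ P.image ∧ f = connectedComponentIn (P.image)ᶜ x

def IsBoundedFace (P : PlaneEmbedding G) (f : Set (ℝ × ℝ)) : Prop :=
  P.IsFace f ∧ IsBounded f

def IsOuterFace (P : PlaneEmbedding G) (f : Set (ℝ × ℝ)) : Prop :=
  P.IsFace f ∧ ¬ IsBounded f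

/-- The vertices on the boundary of a face `f`. -/
def boundaryVerts (P : PlaneEmbedding G) (f : Set (ℝ × ℝ)) : Set V :=
  {v | P.pos v ∈ closure f}

/-- The weak dual: vertices are the bounded faces, two distinct faces being
adjacent when some edge lies on the boundary of both. -/
def weakDual (P : PlaneEmbedding G) :
    SimpleGraph {f : Set (ℝ × ℝ) // P.IsBoundedFace f} :=
  SimpleGraph.fromRel fun f g =>
    ∃ e : G.edgeSet, P.arc e ⊆ closure f.1 ∧ P.arc e ⊆ closure g.1

/-- `u⁺`: the bounded faces having `u` on their boundary. -/
def uPlus (P : PlaneEmbedding G) (u : V) :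
    Set {f : Set (ℝ × ℝ) // P.IsBoundedFace f} :=
  {f | u ∈ P.boundaryVerts f.1}

/-- The drawing of the subgraph induced by a set `S` of vertices. -/
def subImage (P : PlaneEmbedding G) (S : Set V) : Set (ℝ × ℝ) :=
  P.pos '' S ∪ ⋃ e ∈ {e : G.edgeSet | ∀ w, w ∈ (e : Sym2 V) → w ∈ S}, P.arc e

/-- The vertices of `S` lying on the boundary of the unbounded face of the
drawing of the subgraph induced by `S`. -/
def outerVerts (P : PlaneEmbedding G) (S : Set V) : Set V :=
  {v | v ∈ S ∧ ∃ x, x ∉ P.subImage S ∧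
    ¬ IsBounded (connectedComponentIn (P.subImage S)ᶜ x) ∧
    P.pos v ∈ closure (connectedComponentIn (P.subImage S)ᶜ x)}

/-- Remove the outer layer of vertices. -/
def peel (P : PlaneEmbedding G) (S : Set V) : Set V := S \ P.outerVerts S

/-- The embedding is (at most) `k`-outerplanar: `k` rounds of removing the
vertices on the outer boundary remove every vertex. -/
def OuterplanarAtMost (P : PlaneEmbedding G) (k : ℕ) : Prop :=
  (P.peel)^[k] Set.univ = ∅

/-- The drawing of the subgraph of all edges incident to vertices of `R`. -/
def familyImage (P : PlaneEmbedding G) (R : Set V) : Set (ℝ × ℝ) :=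
  ⋃ e ∈ {e : G.edgeSet | ∃ v ∈ R, v ∈ (e : Sym2 V)}, P.arc e

/-- `R` is nicely embedded: no bounded face of the subgraph of edges incident
to `R` strictly encloses a vertex of `G`. -/
def NicelyEmbedded (P : PlaneEmbedding G) (R : Set V) : Prop :=
  ∀ x, x ∉ P.familyImage R →
    IsBounded (connectedComponentIn (P.familyImage R)ᶜ x) →
    ∀ v : V, P.pos v ∉ connectedComponentIn (P.familyImage R)ᶜ x

/-- The facial completion: add a clique on the boundary of each bounded face. -/
def facialCompletion (P : PlaneEmbedding G) : SimpleGraph V :=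
  G ⊔ SimpleGraph.fromRel fun u v =>
    ∃ f, P.IsBoundedFace f ∧ u ∈ P.boundaryVerts f ∧ v ∈ P.boundaryVerts f

end PlaneEmbedding

/-- A tree together with a bag of vertices at each node. -/
structure Decomp (V : Type) : Type 1 where
  ι : Type
  tree : SimpleGraph ι
  isTree : tree.IsTree
  bag : ι → Set V

/-- `D` is a tree decomposition of `G`. -/
def IsTreeDecomp {V : Type} (G : SimpleGraph V) (D : Decomp V) : Prop :=
  (∀ v, ∃ i, v ∈ D.bag i) ∧
  (∀ u v, G.Adj u v → ∃ i, u ∈ D.bag i ∧ v ∈ D.bag i) ∧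
  (∀ v, (D.tree.induce {i | v ∈ D.bag i}).Connected)

/-- The treewidth of a graph. -/
noncomputable def treewidth {V : Type} (G : SimpleGraph V) : ℕ :=
  sInf {k | ∃ D : Decomp V, IsTreeDecomp G D ∧ ∀ i, (D.bag i).ncard ≤ k + 1}

/-- `D` is an embedded tree decomposition of the plane graph given by `P`. -/
def IsEmDecomp {V : Type} {G : SimpleGraph V} (P : PlaneEmbedding G)
    (D : Decomp V) : Prop :=
  IsTreeDecomp G D ∧ ∀ f, P.IsBoundedFace f → ∃ i, P.boundaryVerts f ⊆ D.bag i

/-- The em-width of a plane graph. -/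
noncomputable def emwidth {V : Type} {G : SimpleGraph V}
    (P : PlaneEmbedding G) : ℕ :=
  sInf {k | ∃ D : Decomp V, IsEmDecomp P D ∧ ∀ i, (D.bag i).ncard ≤ k + 1}

/-- A cut vertex: its removal disconnects two vertices that were connected. -/
def SimpleGraph.IsCutVertex {V : Type} (G : SimpleGraph V) (u : V) : Prop :=
  ∃ x y, ∃ (hx : x ≠ u) (hy : y ≠ u), G.Reachable x y ∧
    ¬ (G.induce {v | v ≠ u}).Reachable ⟨x, hx⟩ ⟨y, hy⟩

/-- An `r`-family: `r` vertices of degree 2 sharing the same two neighbors. -/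
def IsRFamily {V : Type} (G : SimpleGraph V) (R : Set V) (r : ℕ) : Prop :=
  R.ncard = r ∧ ∃ a b : V, a ≠ b ∧ ∀ v ∈ R, G.neighborSet v = {a, b}


section Logarithms

open unitInterval

lemma exists_continuous_log_path (f : C(I, ℂ)) (hf : ∀ t, f t ≠ 0) :
    ∃ L : C(I, ℂ), ∀ t, Complex.exp (L t) = f t := by
  obtain ⟨L, hL, -⟩ := Complex.isCoveringMap_exp.exists_path_lifts
    ⟨fun t => (⟨f t, hf t⟩ : {z : ℂ // z ≠ 0}), by fun_prop⟩ (Complex.log (f 0))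
    (by ext; simp [Complex.exp_log (hf 0)])
  exact ⟨L, fun t => congrArg Subtype.val (congrFun hL t)⟩

lemma exists_continuous_log_square (F : C(I × I, ℂ)) (hF : ∀ p, F p ≠ 0) :
    ∃ L : C(I × I, ℂ), ∀ p, Complex.exp (L p) = F p := by
  obtain ⟨f, hf⟩ := exists_continuous_log_path (F.comp ⟨fun t => (0, t), by fun_prop⟩)
    (fun t => hF _)
  let H : C(I × I, {z : ℂ // z ≠ 0}) := ⟨fun p => ⟨F p, hF p⟩, by fun_prop⟩
  have H0 : ∀ a, H (0, a) = ⟨_, (f a).exp_ne_zero⟩ := fun a => Subtype.ext (hf a).symm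
  have h := Complex.isCoveringMap_exp.liftHomotopy_lifts H f H0
  exact ⟨_, fun p => congrArg Subtype.val (congrFun h p)⟩

lemma continuous_log_increment_eq (L L' : C(I, ℂ)) (c : ℂ)
    (h : ∀ t, Complex.exp (L t) = c * Complex.exp (L' t)) : L 1 - L 0 = L' 1 - L' 0 := by
  let f : C(I, {z : ℂ // z ≠ 0}) :=
    ⟨fun t => ⟨Complex.exp (L t), Complex.exp_ne_zero _⟩, by fun_prop⟩
  have h1 := (Complex.isCoveringMap_exp.eq_liftPath_iff' (γ := f) (e := L 0) (γ_0 := rfl)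
    (Γ := L)).2 ⟨rfl, rfl⟩
  have h2 := (Complex.isCoveringMap_exp.eq_liftPath_iff' (γ := f) (e := L 0) (γ_0 := rfl)
    (Γ := L' + ContinuousMap.const I (L 0 - L' 0))).2 ⟨by
      funext t
      apply Subtype.ext
      simp only [Function.comp, ContinuousMap.add_apply, ContinuousMap.const_apply, f,
        ContinuousMap.coe_mk]
      rw [Complex.exp_add, Complex.exp_sub, h 0, h t]
      field_simp [Complex.exp_ne_zero], by simp⟩
  have h3 := congrArg (fun g : C(I, ℂ) => g 1) (h1.trans h2.symm)
  simp only [ContinuousMap.add_apply, ContinuousMap.const_apply] at h3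
  linear_combination h3

end Logarithms

namespace SimpleGraph

variable {V : Type}

/-- Vanishing of the van Kampen obstruction modulo two. The bit `k x y` compares the directions
from `x` to `y` and from `y` to `x`, and `n a b w` is the parity of the winding of the edge `ab`
around the vertex `w`. -/
def VanKampenTrivial (G : SimpleGraph V) : Prop :=
  ∃ (k : V → V → ZMod 2) (n : V → V → V → ZMod 2),
    (∀ x y, x ≠ y → k x y + k y x = 1) ∧
    ∀ a b c d, G.Adj a b → G.Adj c d → a ≠ c → a ≠ d → b ≠ c → b ≠ d →
      k a c + k a d + k b c + k b d = n a b c + n a b d + n c d a + n c d b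

end SimpleGraph

namespace PlaneEmbedding

open unitInterval

variable {V : Type} {G : SimpleGraph V}

lemma exists_arc_path (P : PlaneEmbedding G) {c d : V} (h : G.Adj c d) :
    ∃ γ : Path (P.pos c) (P.pos d), Set.range γ = P.arc ⟨s(c, d), h⟩ := by
  obtain ⟨u, v, huv, γ, -, hγ⟩ := P.arc_path ⟨s(c, d), h⟩
  rcases Sym2.eq_iff.1 huv with ⟨rfl, rfl⟩ | ⟨rfl, rfl⟩
  · exact ⟨γ, hγ⟩
  · exact ⟨γ.symm, by rw [Path.symm_range, hγ]⟩

lemma vanKampenTrivial (P : PlaneEmbedding G) : G.VanKampenTrivial := by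
  classical
  let toC : C(ℝ × ℝ, ℂ) := ⟨fun p => p.1 + p.2 * Complex.I, by fun_prop⟩
  have toC_inj : Function.Injective toC := by
    intro p q h
    have h1 := congrArg Complex.re h
    have h2 := congrArg Complex.im h
    simp [toC] at h1 h2
    exact Prod.ext h1 h2
  let Z : V → ℂ := fun v => toC (P.pos v)
  have Z_inj : Function.Injective Z := toC_inj.comp P.pos_inj
  have curve : ∀ c d : V, ∃ g : C(I, ℂ), ∀ h : G.Adj c d,
      g 0 = Z c ∧ g 1 = Z d ∧ ∀ t, ∃ x ∈ P.arc ⟨s(c, d), h⟩, g t = toC x := by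
    intro c d
    by_cases h : G.Adj c d
    · obtain ⟨γ, hγ⟩ := P.exists_arc_path h
      refine ⟨toC.comp γ.toContinuousMap, fun _ => ⟨?_, ?_, fun t => ⟨γ t, ?_, rfl⟩⟩⟩
      · simp [Z]
      · simp [Z]
      · rw [← hγ]; exact ⟨t, rfl⟩
    · exact ⟨0, fun h' => absurd h' h⟩
  choose g hg using curve
  have g_ne : ∀ c d w, G.Adj c d → w ≠ c → w ≠ d → ∀ t, g c d t - Z w ≠ 0 := by
    intro c d w h hc hd t h0
    obtain ⟨x, hx, hx'⟩ := (hg c d h).2.2 t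
    have : x = P.pos w := toC_inj (by rw [← hx']; exact sub_eq_zero.1 h0)
    have := P.arc_avoid _ w (this ▸ hx)
    simp at this
    tauto
  have g_ne' : ∀ a b c d, G.Adj a b → G.Adj c d → a ≠ c → a ≠ d → b ≠ c → b ≠ d →
      ∀ s t, g a b s - g c d t ≠ 0 := by
    intro a b c d hab hcd hac had hbc hbd s t h0
    obtain ⟨x, hx, hx'⟩ := (hg a b hab).2.2 s
    obtain ⟨y, hy, hy'⟩ := (hg c d hcd).2.2 t
    have hxy : x = y := toC_inj (by rw [← hx', ← hy']; exact sub_eq_zero.1 h0)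
    subst hxy
    obtain ⟨w, hw1, hw2, -⟩ := P.arc_inter ⟨s(a, b), hab⟩ ⟨s(c, d), hcd⟩ (by
      intro h
      have := Sym2.eq_iff.1 (congrArg Subtype.val h)
      tauto) x ⟨hx, hy⟩
    simp at hw1 hw2
    rcases hw1 with rfl | rfl <;> rcases hw2 with rfl | rfl <;> tauto
  have lift : ∀ c d w, ∃ L : C(I, ℂ), (G.Adj c d → w ≠ c → w ≠ d →
      ∀ t, Complex.exp (L t) = g c d t - Z w) := by
    intro c d w
    by_cases h : G.Adj c d ∧ w ≠ c ∧ w ≠ d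
    · obtain ⟨L, hL⟩ := exists_continuous_log_path (g c d - ContinuousMap.const I (Z w))
        (g_ne c d w h.1 h.2.1 h.2.2)
      exact ⟨L, fun _ _ _ => hL⟩
    · exact ⟨0, fun h1 h2 h3 => absurd ⟨h1, h2, h3⟩ h⟩
  choose L hL using lift
  let A : V → V → ℂ := fun x y => Complex.log (Z y - Z x)
  have hA : ∀ x y, x ≠ y → Complex.exp (A x y) = Z y - Z x := fun x y h =>
    Complex.exp_log (sub_ne_zero.2 fun h' => h (Z_inj h').symm)
  have hk : ∀ x y, ∃ k : ℤ, x ≠ y →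
      A x y = A y x + Real.pi * Complex.I + k * (2 * Real.pi * Complex.I) := by
    intro x y
    by_cases h : x = y
    · exact ⟨0, fun h' => absurd h h'⟩
    · have : Complex.exp (A x y) = Complex.exp (A y x + Real.pi * Complex.I) := by
        rw [Complex.exp_add, hA _ _ h, hA _ _ (Ne.symm h), Complex.exp_pi_mul_I]; ring
      obtain ⟨k, hk⟩ := Complex.exp_eq_exp_iff_exists_int.1 this
      exact ⟨k, fun _ => hk⟩
  choose k hk using hk
  have hn : ∀ c d w, ∃ n : ℤ, G.Adj c d → w ≠ c → w ≠ d →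
      L c d w 1 - L c d w 0 = A w d - A w c + n * (2 * Real.pi * Complex.I) := by
    intro c d w
    by_cases h : G.Adj c d ∧ w ≠ c ∧ w ≠ d
    · obtain ⟨h, hc, hd⟩ := h
      have : Complex.exp (L c d w 1 - L c d w 0) = Complex.exp (A w d - A w c) := by
        rw [Complex.exp_sub, Complex.exp_sub, hA _ _ hc, hA _ _ hd, hL c d w h hc hd,
          hL c d w h hc hd, (hg c d h).1, (hg c d h).2.1]
      obtain ⟨n, hn⟩ := Complex.exp_eq_exp_iff_exists_int.1 this
      exact ⟨n, fun _ _ _ => hn⟩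
    · exact ⟨0, fun h1 h2 h3 => absurd ⟨h1, h2, h3⟩ h⟩
  choose n hn using hn
  have h2pi : (2 * Real.pi * Complex.I : ℂ) ≠ 0 := Complex.two_pi_I_ne_zero
  refine ⟨fun x y => k x y, fun a b w => n a b w, fun x y hxy => ?_, ?_⟩
  · have h1 := hk x y hxy
    have h2 := hk y x hxy.symm
    have h3 : ((k x y + k y x + 1 : ℤ) : ℂ) * (2 * Real.pi * Complex.I) = 0 := by
      push_cast
      linear_combination -h1 - h2
    have h4 := Int.cast_eq_zero.1 ((mul_eq_zero.1 h3).resolve_right h2pi)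
    have h5 := congrArg (Int.cast : ℤ → ZMod 2) h4
    push_cast at h5
    linear_combination h5 - CharTwo.two_eq_zero (R := ZMod 2)
  · intro a b c d hab hcd hac had hbc hbd
    obtain ⟨S, hS⟩ := exists_continuous_log_square
      ⟨fun p => g a b p.1 - g c d p.2, by fun_prop⟩
      (fun p => g_ne' a b c d hab hcd hac had hbc hbd p.1 p.2)
    simp only [ContinuousMap.coe_mk] at hS
    obtain ⟨ga, gb, -⟩ := hg a b hab
    obtain ⟨gc, gd, -⟩ := hg c d hcd
    have e1 := continuous_log_increment_eq (S.comp ⟨fun t => (t, 0), by fun_prop⟩) (L a b c) 1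
      (fun t => by simp [hS, hL a b c hab hac.symm hbc.symm, gc])
    have e2 := continuous_log_increment_eq (S.comp ⟨fun t => (t, 1), by fun_prop⟩) (L a b d) 1
      (fun t => by simp [hS, hL a b d hab had.symm hbd.symm, gd])
    have e3 := continuous_log_increment_eq (S.comp ⟨fun t => (0, t), by fun_prop⟩) (L c d a) (-1)
      (fun t => by simp [hS, hL c d a hcd hac had, ga])
    have e4 := continuous_log_increment_eq (S.comp ⟨fun t => (1, t), by fun_prop⟩) (L c d b) (-1)
      (fun t => by simp [hS, hL c d b hcd hbc hbd, gb])
    simp only [ContinuousMap.comp_apply, ContinuousMap.coe_mk] at e1 e2 e3 e4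
    rw [hn a b c hab hac.symm hbc.symm] at e1
    rw [hn a b d hab had.symm hbd.symm] at e2
    rw [hn c d a hcd hac had] at e3
    rw [hn c d b hcd hbc hbd] at e4
    have h3 : ((k a c - k a d - k b c + k b d + n a b c - n a b d - n c d a + n c d b : ℤ) : ℂ)
        * (2 * Real.pi * Complex.I) = 0 := by
      push_cast
      linear_combination e2 + e3 - e1 - e4 - hk a c hac + hk a d had + hk b c hbc - hk b d hbd
    have h4 := Int.cast_eq_zero.1 ((mul_eq_zero.1 h3).resolve_right h2pi)
    have h5 := congrArg (Int.cast : ℤ → ZMod 2) h4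
    push_cast at h5
    linear_combination h5 + (k a d + k b c - n a b c - n c d b) *
      CharTwo.two_eq_zero (R := ZMod 2)

end PlaneEmbedding

namespace SimpleGraph.VanKampenTrivial

variable {V : Type} {G : SimpleGraph V}

/-- The van Kampen condition passes to any graph whose edges are represented by walks such that
independent edges have disjoint walks; the walk of `ab` stays in `{a, b} ∪ M a b`. -/
lemma of_walks (hG : G.VanKampenTrivial) {H : SimpleGraph V} (M : V → V → Set V)
    (hwalk : ∀ a b, H.Adj a b →
      ∃ p : G.Walk a b, ∀ w ∈ p.support, w = a ∨ w = b ∨ w ∈ M a b)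
    (hdisj : ∀ a b c d, H.Adj a b → H.Adj c d → a ≠ c → a ≠ d → b ≠ c → b ≠ d →
      ∀ w ∈ M a b, w ≠ c ∧ w ≠ d ∧ w ∉ M c d) : H.VanKampenTrivial := by
  classical
  obtain ⟨k, n, hk, hn⟩ := hG
  let N {a b : V} (p : G.Walk a b) (w : V) : ZMod 2 := (p.darts.map fun e => n e.fst e.snd w).sum
  have two : (2 : ZMod 2) = 0 := CharTwo.two_eq_zero
  have walk_edge : ∀ {a b : V} (p : G.Walk a b) {c d : V}, G.Adj c d → c ∉ p.support →
      d ∉ p.support →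
      k a c + k a d + k b c + k b d = N p c + N p d + n c d a + n c d b := by
    intro a b p
    induction p with
    | nil =>
      intro c d _ _ _
      simp only [N, Walk.darts_nil, List.map_nil, List.sum_nil]
      linear_combination (k _ c + k _ d - n c d _) * two
    | @cons a a' b h p ih =>
      intro c d hcd hc hd
      simp only [Walk.support_cons, List.mem_cons, not_or] at hc hd
      have h1 := ih hcd hc.2 hd.2
      have h2 := hn a a' c d h hcd (Ne.symm hc.1) (Ne.symm hd.1)
        (fun e => hc.2 (e ▸ p.start_mem_support)) (fun e => hd.2 (e ▸ p.start_mem_support))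
      simp only [N, Walk.darts_cons, List.map_cons, List.sum_cons] at h1 ⊢
      linear_combination h1 + h2 - (k a' c + k a' d - n c d a') * two
  have walk_walk : ∀ {a b : V} (p : G.Walk a b) {c d : V} (q : G.Walk c d),
      (∀ w ∈ p.support, w ∉ q.support) →
      k a c + k a d + k b c + k b d = N p c + N p d + N q a + N q b := by
    intro a b p c d q
    induction q with
    | nil =>
      intro _
      simp only [N, Walk.darts_nil, List.map_nil, List.sum_nil]
      linear_combination (k a _ + k b _ - N p _) * two
    | @cons c c' d h q ih =>
      intro hd
      have h1 := ih fun w hw hw' => hd w hw (by simp [hw'])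
      have h2 := walk_edge p h (fun h' => hd _ h' (by simp))
        (fun h' => hd _ h' (by simp))
      simp only [N, Walk.darts_cons, List.map_cons, List.sum_cons] at h1 h2 ⊢
      linear_combination h1 + h2 - (k a c' + k b c' - N p c') * two
  choose p hp using hwalk
  refine ⟨k, fun a b w => if h : H.Adj a b then N (p a b h) w else 0, hk, ?_⟩
  intro a b c d hab hcd hac had hbc hbd
  simp only [hab, hcd, dif_pos]
  refine walk_walk _ _ fun w hw hw' => ?_
  have h1 := hdisj a b c d hab hcd hac had hbc hbd w
  have h2 := hdisj c d a b hcd hab hac.symm hbc.symm had.symm hbd.symm w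
  rcases hp a b hab w hw with rfl | rfl | hw1 <;> rcases hp c d hcd w hw' with rfl | rfl | hw2 <;>
    tauto

lemma cliqueFree_five (hG : G.VanKampenTrivial) : G.CliqueFree 5 := by
  by_contra h
  have e := topEmbeddingOfNotCliqueFree h
  obtain ⟨k, n, hk, hn⟩ := hG
  have q : ∀ i j l m : Fin 5, i ≠ j ∧ l ≠ m ∧ i ≠ l ∧ i ≠ m ∧ j ≠ l ∧ j ≠ m → _ :=
    fun i j l m h => hn (e i) (e j) (e l) (e m) (e.map_adj_iff.2 h.1) (e.map_adj_iff.2 h.2.1)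
      (e.injective.ne h.2.2.1) (e.injective.ne h.2.2.2.1) (e.injective.ne h.2.2.2.2.1)
      (e.injective.ne h.2.2.2.2.2)
  have r : ∀ i j : Fin 5, i ≠ j → _ := fun i j h => hk (e i) (e j) (e.injective.ne h)
  have key : (1 : ZMod 2) = 0 := by
    linear_combination (norm := skip)
      q 0 1 2 3 (by decide) + q 0 2 1 3 (by decide) + q 0 3 1 2 (by decide)
      + q 0 1 2 4 (by decide) + q 0 2 1 4 (by decide) + q 0 4 1 2 (by decide)
      + q 0 1 3 4 (by decide) + q 0 3 1 4 (by decide) + q 0 4 1 3 (by decide)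
      + q 0 2 3 4 (by decide) + q 0 3 2 4 (by decide) + q 0 4 2 3 (by decide)
      + q 1 2 3 4 (by decide) + q 1 3 2 4 (by decide) + q 1 4 2 3 (by decide)
      + r 2 3 (by decide) + r 2 4 (by decide) + r 3 4 (by decide)
    ring_nf
    reduce_mod_char
  exact absurd key (by decide)

lemma no_three_three (hG : G.VanKampenTrivial) (f g : Fin 3 → V) (hf : Function.Injective f)
    (hg : Function.Injective g) (h : ∀ i j, G.Adj (f i) (g j)) : False := by
  obtain ⟨k, n, hk, hn⟩ := hG
  have q : ∀ i j l m : Fin 3, i ≠ l ∧ j ≠ m → _ :=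
    fun i j l m hh => hn (f i) (g j) (f l) (g m) (h i j) (h l m) (hf.ne hh.1) (h i m).ne
      (h l j).ne.symm (hg.ne hh.2)
  have r : ∀ i j : Fin 3, i ≠ j → _ := fun i j hh => hk (g i) (g j) (hg.ne hh)
  have key : (1 : ZMod 2) = 0 := by
    linear_combination (norm := skip)
      q 0 0 1 1 (by decide) + q 0 0 1 2 (by decide) + q 0 1 1 0 (by decide)
      + q 0 1 1 2 (by decide) + q 0 2 1 0 (by decide) + q 0 2 1 1 (by decide)
      + q 0 0 2 1 (by decide) + q 0 0 2 2 (by decide) + q 0 1 2 0 (by decide)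
      + q 0 1 2 2 (by decide) + q 0 2 2 0 (by decide) + q 0 2 2 1 (by decide)
      + q 1 0 2 1 (by decide) + q 1 0 2 2 (by decide) + q 1 1 2 0 (by decide)
      + q 1 1 2 2 (by decide) + q 1 2 2 0 (by decide) + q 1 2 2 1 (by decide)
      + r 0 1 (by decide) + r 0 2 (by decide) + r 1 2 (by decide)
    ring_nf
    reduce_mod_char
  exact absurd key (by decide)

end SimpleGraph.VanKampenTrivial
namespace SimpleGraph

variable {V : Type}

/-- The contraction of `v` into `u`, leaving `v` as an isolated vertex. -/
def contractInto (G : SimpleGraph V) (u v : V) : SimpleGraph V where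
  Adj x y := x ≠ y ∧ x ≠ v ∧ y ≠ v ∧ (G.Adj x y ∨ (x = u ∧ G.Adj v y) ∨ (y = u ∧ G.Adj v x))
  symm := ⟨fun x y h => by
    obtain ⟨h1, h2, h3, h4⟩ := h
    rw [G.adj_comm x y] at h4
    tauto⟩
  loopless := ⟨fun x h => h.1 rfl⟩

/-- The graph in which every `v ∈ I` is replaced by a clique on `T v`. -/
def cliqueReplacement (I : Finset V) (T : V → Finset V) : SimpleGraph V where
  Adj x y := x ≠ y ∧ ∃ v ∈ I, x ∈ T v ∧ y ∈ T v
  symm := ⟨fun x y h => by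
    obtain ⟨h1, v, h2, h3, h4⟩ := h
    exact ⟨h1.symm, v, h2, h4, h3⟩⟩
  loopless := ⟨fun x h => h.1 rfl⟩

namespace VanKampenTrivial

variable {G : SimpleGraph V}

lemma contractInto (hG : G.VanKampenTrivial) {u v : V} (huv : G.Adj u v) :
    (G.contractInto u v).VanKampenTrivial := by
  classical
  refine hG.of_walks (fun x y => {w | w = v ∧ ¬ G.Adj x y}) ?_ ?_
  · rintro x y ⟨hxy, hx, hy, h⟩
    by_cases hadj : G.Adj x y
    · exact ⟨.cons hadj .nil, by simp⟩
    · rcases h with h | ⟨rfl, h⟩ | ⟨rfl, h⟩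
      · exact absurd h hadj
      · exact ⟨.cons huv (.cons h .nil), by simp [hadj]⟩
      · exact ⟨.cons h.symm (.cons huv.symm .nil), by simp [hadj]⟩
  · rintro a b c d ⟨hab, ha, hb, h⟩ ⟨hcd, hc, hd, h'⟩ hac had hbc hbd w ⟨rfl, hw⟩
    refine ⟨hc.symm, hd.symm, fun hw' => ?_⟩
    have hw2 := hw'.2
    rcases h with h | h | h
    · exact hw h
    all_goals
    · rcases h' with h' | h' | h'
      · exact hw2 h'
      · exact absurd (h.1.trans h'.1.symm) (by assumption)
      · exact absurd (h.1.trans h'.1.symm) (by assumption)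

lemma cliqueReplacement (hG : G.VanKampenTrivial) {I C : Finset V} {T : V → Finset V}
    (hCI : Disjoint C I) (hT : ∀ v ∈ I, T v ⊆ C ∧ (T v).card ≤ 3 ∧ ∀ c ∈ T v, G.Adj v c) :
    (cliqueReplacement I T).VanKampenTrivial := by
  classical
  have hmid : ∀ x y, ∃ v, (SimpleGraph.cliqueReplacement I T).Adj x y →
      v ∈ I ∧ x ∈ T v ∧ y ∈ T v := by
    intro x y
    by_cases h : (SimpleGraph.cliqueReplacement I T).Adj x y
    · obtain ⟨-, v, hv⟩ := h
      exact ⟨v, fun _ => hv⟩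
    · exact ⟨x, fun h' => absurd h' h⟩
  choose m hm using hmid
  refine hG.of_walks (fun x y => {m x y}) ?_ ?_
  · intro x y hxy
    obtain ⟨h1, h2, h3⟩ := hm x y hxy
    have h4 := (hT _ h1).2.2
    exact ⟨.cons (h4 _ h2).symm (.cons (h4 _ h3) .nil), by simp⟩
  · rintro a b c d hab hcd hac had hbc hbd w rfl
    obtain ⟨h1, h2, h3⟩ := hm a b hab
    obtain ⟨h1', h2', h3'⟩ := hm c d hcd
    refine ⟨fun h => ?_, fun h => ?_, fun h => ?_⟩
    · exact Finset.disjoint_left.1 hCI ((hT _ h1').1 h2') (h ▸ h1)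
    · exact Finset.disjoint_left.1 hCI ((hT _ h1').1 h3') (h ▸ h1)
    · have h : m a b = m c d := h
      rw [← h] at h2' h3'
      have hsub : ({a, b, c, d} : Finset V) ⊆ T (m a b) := by
        intro x hx
        simp only [Finset.mem_insert, Finset.mem_singleton] at hx
        rcases hx with rfl | rfl | rfl | rfl <;> assumption
      have := Finset.card_le_card hsub
      have hab := hab.1
      have hcd := hcd.1
      rw [Finset.card_insert_of_notMem (by simp; tauto),
        Finset.card_insert_of_notMem (by simp; tauto), Finset.card_pair hcd] at this
      have := (hT _ h1).2.1
      omega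

open Classical in
/-- Density bound, by induction on `j`: a vertex set completely joined to a clique of size `3 - j`
spans few edges. -/
lemma sum_degree_lt (j : ℕ) : ∀ (m : ℕ) (G : SimpleGraph V), G.VanKampenTrivial →
    ∀ (k : ℕ) (K S : Finset V), k + j = 3 → G.IsNClique k K → (∀ x ∈ K, ∀ y ∈ S, G.Adj x y) →
      S.Nonempty → S.card = m →
      ∑ x ∈ S, (S.filter (G.Adj x)).card < 2 ^ j * S.card := by
  induction j with
  | zero =>
    intro m G hG k K S hk hK hKS hS _
    have : ∑ x ∈ S, (S.filter (G.Adj x)).card = 0 := by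
      refine Finset.sum_eq_zero fun x hx => ?_
      rw [Finset.card_eq_zero, Finset.filter_eq_empty_iff]
      intro y hy hxy
      have h1 := hK.insert (a := y) fun b hb => (hKS b hb y hy).symm
      have h2 := h1.insert (a := x) fun b hb => by
        rcases Finset.mem_insert.1 hb with rfl | hb
        · exact hxy
        · exact (hKS b hb x hx).symm
      obtain rfl : k = 3 := by omega
      exact hG.cliqueFree_five _ h2
    rw [this]
    simpa using hS
  | succ j ihj =>
    intro m
    induction m with
    | zero =>
      intro G _ k K S _ _ _ hS h0
      exact absurd (Finset.card_pos.2 hS) (by omega)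
    | succ m ihm =>
      intro G hG k K S hk hK hKS hS hm
      by_cases hE : ∀ v ∈ S, S.filter (G.Adj v) = ∅
      · rw [Finset.sum_eq_zero fun x hx => by rw [hE x hx, Finset.card_empty]]
        have := Finset.card_pos.2 hS
        positivity
      push Not at hE
      obtain ⟨v, hv, hN⟩ := hE
      set N := S.filter (G.Adj v) with hNdef
      have hNS : N ⊆ S := Finset.filter_subset _ _
      have hlt := ihj N.card G hG (k + 1) (insert v K) N (by omega)
        (hK.insert fun b hb => (hKS b hb v hv).symm) (fun x hx y hy => by
          rcases Finset.mem_insert.1 hx with rfl | hx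
          · exact (Finset.mem_filter.1 hy).2
          · exact hKS x hx y (hNS hy)) hN rfl
      obtain ⟨u, hu, hdeg⟩ : ∃ u ∈ N, (N.filter (G.Adj u)).card < 2 ^ j := by
        by_contra! h
        have := Finset.sum_le_sum h
        simp only [Finset.sum_const, smul_eq_mul] at this
        rw [mul_comm] at this
        omega
      have huS : u ∈ S := hNS hu
      have hvu : G.Adj v u := (Finset.mem_filter.1 hu).2
      set S' := S.erase v with hS'
      have huS' : u ∈ S' := Finset.mem_erase.2 ⟨hvu.ne.symm, huS⟩
      have hvK : v ∉ K := fun h => (hKS v h v hv).ne rfl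
      have hcard : S'.card = m := by rw [Finset.card_erase_of_mem hv]; omega
      have hS'S : S' ⊆ S := Finset.erase_subset _ _
      have hmono : ∀ x y, x ≠ v → y ≠ v → G.Adj x y → (G.contractInto u v).Adj x y :=
        fun x y hx hy h => ⟨h.ne, hx, hy, Or.inl h⟩
      have hKv : ∀ x ∈ K, x ≠ v := fun x hx h => hvK (h ▸ hx)
      have hih := ihm (G.contractInto u v) (hG.contractInto hvu.symm) k K S' hk
        ⟨fun x hx y hy hxy => hmono x y (hKv x hx) (hKv y hy) (hK.isClique hx hy hxy),
          hK.card_eq⟩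
        (fun x hx y hy => hmono x y (hKv x hx) (Finset.ne_of_mem_erase hy) (hKS x hx y (hS'S hy)))
        ⟨u, huS'⟩ hcard
      set Y := (N.erase u).filter (fun y => ¬ G.Adj u y) with hY
      have hYN : N.card ≤ Y.card + 2 ^ j := by
        have h1 : ((N.erase u).filter (G.Adj u)).card + Y.card = (N.erase u).card := by
          rw [hY]
          convert Finset.card_filter_add_card_filter_not (s := N.erase u) (G.Adj u)
        have h2 : ((N.erase u).filter (G.Adj u)).card ≤ (N.filter (G.Adj u)).card :=
          Finset.card_le_card (Finset.filter_subset_filter _ (Finset.erase_subset _ _))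
        have h3 := Finset.card_erase_add_one hu
        omega
      have hNS' : N ⊆ S' := fun y hy =>
        Finset.mem_erase.2 ⟨(Finset.mem_filter.1 hy).2.ne.symm, hNS hy⟩
      have hYS' : Y ⊆ S' := (Finset.filter_subset _ _).trans ((Finset.erase_subset _ _).trans hNS')
      have hYadj : ∀ y ∈ Y, (G.contractInto u v).Adj u y ∧ ¬ G.Adj u y := by
        intro y hy
        obtain ⟨h1, h2⟩ := Finset.mem_filter.1 hy
        obtain ⟨h3, h4⟩ := Finset.mem_erase.1 h1
        have h5 := (Finset.mem_filter.1 h4).2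
        exact ⟨⟨h3.symm, hvu.ne.symm, h5.ne.symm, Or.inr (Or.inl ⟨rfl, h5⟩)⟩, h2⟩
      have hupper : ∑ x ∈ S, (S.filter (G.Adj x)).card =
          ∑ x ∈ S', (S'.filter (G.Adj x)).card + 2 * N.card := by
        rw [← Finset.add_sum_erase S _ hv]
        have : ∀ x ∈ S', (S.filter (G.Adj x)).card =
            (S'.filter (G.Adj x)).card + if x ∈ N then 1 else 0 := by
          intro x hx
          by_cases hxv : G.Adj x v
          · have : x ∈ N := Finset.mem_filter.2 ⟨hS'S hx, hxv.symm⟩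
            rw [if_pos this, hS', Finset.filter_erase, Finset.card_erase_add_one]
            exact Finset.mem_filter.2 ⟨hv, hxv⟩
          · have : x ∉ N := fun h => hxv (Finset.mem_filter.1 h).2.symm
            rw [if_neg this, hS', Finset.filter_erase, Finset.erase_eq_of_notMem, add_zero]
            exact fun h => hxv (Finset.mem_filter.1 h).2
        rw [Finset.sum_congr rfl this, Finset.sum_add_distrib, Finset.sum_boole,
          Finset.filter_mem_eq_inter, Finset.inter_eq_right.2 hNS']
        simp only [Nat.cast_id]
        change N.card + _ = _
        ring
      have hlower : ∑ x ∈ S', (S'.filter (G.Adj x)).card + 2 * Y.card ≤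
          ∑ x ∈ S', (S'.filter ((G.contractInto u v).Adj x)).card := by
        have : ∀ x ∈ S', (S'.filter (G.Adj x)).card + (if x = u then Y.card else 0) +
            (if x ∈ Y then 1 else 0) ≤ (S'.filter ((G.contractInto u v).Adj x)).card := by
          intro x hx
          have hsub : S'.filter (G.Adj x) ⊆ S'.filter ((G.contractInto u v).Adj x) := by
            intro y hy
            obtain ⟨h1, h2⟩ := Finset.mem_filter.1 hy
            exact Finset.mem_filter.2 ⟨h1, hmono x y (Finset.ne_of_mem_erase hx)
              (Finset.ne_of_mem_erase h1) h2⟩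
          by_cases hxu : x = u
          · subst hxu
            have : x ∉ Y := fun h => (hYadj x h).1.ne rfl
            rw [if_pos rfl, if_neg this, add_zero, ← Finset.card_union_of_disjoint]
            · refine Finset.card_le_card (Finset.union_subset hsub fun y hy => ?_)
              exact Finset.mem_filter.2 ⟨hYS' hy, (hYadj y hy).1⟩
            · exact Finset.disjoint_left.2 fun y hy hy' =>
                (hYadj y hy').2 (Finset.mem_filter.1 hy).2
          · rw [if_neg hxu, add_zero]
            by_cases hxY : x ∈ Y
            · rw [if_pos hxY, Nat.succ_le_iff]
              refine Finset.card_lt_card ((Finset.ssubset_iff_of_subset hsub).2 ⟨u, ?_, ?_⟩)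
              · exact Finset.mem_filter.2 ⟨huS', (hYadj x hxY).1.symm⟩
              · exact fun h => (hYadj x hxY).2 (Finset.mem_filter.1 h).2.symm
            · rw [if_neg hxY, add_zero]
              exact Finset.card_le_card hsub
        have := Finset.sum_le_sum this
        rw [Finset.sum_add_distrib, Finset.sum_add_distrib, Finset.sum_ite_eq' S' u, if_pos huS',
          Finset.sum_boole, Finset.filter_mem_eq_inter, Finset.inter_eq_right.2 hYS'] at this
        simp only [Nat.cast_id] at this
        omega
      rw [hupper, hm]
      rw [hcard] at hih
      have : 2 ^ (j + 1) * (m + 1) = 2 ^ (j + 1) * m + 2 * 2 ^ j := by ring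
      omega

end VanKampenTrivial

end SimpleGraph

namespace SimpleGraph.VanKampenTrivial

variable {V : Type} {G : SimpleGraph V}

open Classical in
lemma card_common_le_two (hG : G.VanKampenTrivial) {I : Finset V} {T : V → Finset V}
    (hT : ∀ v ∈ I, ∀ c ∈ T v, G.Adj v c) {a b c : V} (hab : a ≠ b) (hac : a ≠ c) (hbc : b ≠ c) :
    (I.filter fun v => a ∈ T v ∧ b ∈ T v ∧ c ∈ T v).card ≤ 2 := by
  by_contra! h
  obtain ⟨x, y, z, hx, hy, hz, hxy, hxz, hyz⟩ := Finset.two_lt_card_iff.1 h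
  simp only [Finset.mem_filter] at hx hy hz
  refine hG.no_three_three ![x, y, z] ![a, b, c] ?_ ?_ ?_
  · intro i j; fin_cases i <;> fin_cases j <;> simp [hxy, hxz, hyz, hxy.symm, hxz.symm, hyz.symm]
  · intro i j; fin_cases i <;> fin_cases j <;> simp [hab, hac, hbc, hab.symm, hac.symm, hbc.symm]
  · have hx' := hT x hx.1
    have hy' := hT y hy.1
    have hz' := hT z hz.1
    intro i j
    fin_cases i <;> fin_cases j <;> simp <;> simp_all

open Classical in
/-- Some pair of vertices of `C` with a common neighbour in `I` has at most seven such common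
neighbours. -/
lemma exists_pair_card_common_le (hG : G.VanKampenTrivial) {I C : Finset V} {T : V → Finset V}
    (hCI : Disjoint C I) (hT : ∀ v ∈ I, T v ⊆ C ∧ (T v).card = 3 ∧ ∀ c ∈ T v, G.Adj v c)
    (hI : I.Nonempty) :
    ∃ v ∈ I, ∃ a ∈ T v, ∃ b ∈ T v, a ≠ b ∧
      (I.filter fun w => a ∈ T w ∧ b ∈ T w).card ≤ 7 := by
  by_contra! hmany
  set H := SimpleGraph.cliqueReplacement I T with hH
  have hHG : H.VanKampenTrivial :=
    hG.cliqueReplacement hCI fun v hv => ⟨(hT v hv).1, (hT v hv).2.1.le, (hT v hv).2.2⟩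
  obtain ⟨v, hv⟩ := hI
  obtain ⟨a, ha⟩ : (T v).Nonempty := Finset.card_pos.1 (by rw [(hT v hv).2.1]; omega)
  obtain ⟨b, hb, hba⟩ := Finset.exists_mem_ne (by rw [(hT v hv).2.1]; omega) a
  set S := C.filter (H.Adj a) with hS
  have hbS : b ∈ S := Finset.mem_filter.2 ⟨(hT v hv).1 hb, hba.symm, v, hv, ha, hb⟩
  have hlt := hHG.sum_degree_lt 2 S.card H 1 {a} S rfl (by simp) (by simp [hS]) ⟨b, hbS⟩ rfl
  have hge : ∀ x ∈ S, 4 ≤ (S.filter (H.Adj x)).card := by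
    intro x hx
    obtain ⟨-, hax, w, hw, haw, hxw⟩ := Finset.mem_filter.1 hx
    have h8 := hmany w hw a haw x hxw hax
    have hthird : ∀ w, ∃ y, w ∈ I → y ∈ T w ∧ y ≠ a ∧ y ≠ x := by
      intro w
      by_cases hw : w ∈ I
      · obtain ⟨y, hy, hy'⟩ := Finset.exists_mem_notMem_of_card_lt_card (s := {a, x}) (t := T w)
          (by rw [(hT w hw).2.1]; exact Finset.card_le_two.trans_lt (by omega))
        simp only [Finset.mem_insert, Finset.mem_singleton, not_or] at hy'
        exact ⟨y, fun _ => ⟨hy, hy'⟩⟩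
      · exact ⟨a, fun h => absurd h hw⟩
    choose f hf using hthird
    have := Finset.card_le_mul_card_image_of_maps_to
      (s := I.filter fun w => a ∈ T w ∧ x ∈ T w) (t := S.filter (H.Adj x)) (f := f) (by
        intro w hw
        obtain ⟨hw, haw, hxw⟩ := Finset.mem_filter.1 hw
        obtain ⟨h1, h2, h3⟩ := hf w hw
        exact Finset.mem_filter.2 ⟨Finset.mem_filter.2 ⟨(hT w hw).1 h1, h2.symm, w, hw, haw, h1⟩,
          h3.symm, w, hw, hxw, h1⟩) 2 (by
        intro y hy
        obtain ⟨h1, hxy⟩ := Finset.mem_filter.1 hy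
        obtain ⟨-, hay⟩ := Finset.mem_filter.1 h1
        refine (Finset.card_le_card ?_).trans
          (hG.card_common_le_two (fun v hv => (hT v hv).2.2) hax hay.ne hxy.ne)
        intro w hw
        simp only [Finset.mem_filter] at hw ⊢
        exact ⟨hw.1.1, hw.1.2.1, hw.1.2.2, hw.2 ▸ (hf w hw.1.1).1⟩)
    omega
  have := Finset.sum_le_sum hge
  simp only [Finset.sum_const, smul_eq_mul] at this
  omega

lemma card_le_seven_mul (m : ℕ) : ∀ (G : SimpleGraph V), G.VanKampenTrivial →
    ∀ (I C : Finset V) (T : V → Finset V), Disjoint C I →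
      (∀ v ∈ I, T v ⊆ C ∧ (T v).card = 3 ∧ ∀ c ∈ T v, G.Adj v c) → C.card = m →
      I.card ≤ 7 * C.card := by
  classical
  induction m with
  | zero =>
    intro G hG I C T hCI hT hC
    rcases I.eq_empty_or_nonempty with rfl | ⟨v, hv⟩
    · simp
    · have h1 := Finset.card_le_card (hT v hv).1
      have := (hT v hv).2.1
      omega
  | succ m ih =>
    intro G hG I C T hCI hT hC
    rcases I.eq_empty_or_nonempty with rfl | hI
    · simp
    obtain ⟨v, hv, a, ha, b, hb, hab, h7⟩ := hG.exists_pair_card_common_le hCI hT hI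
    have hva := (hT v hv).2.2 a ha
    have hvb := (hT v hv).2.2 b hb
    have hab' : (G.contractInto a v).Adj a b :=
      ⟨hab, hva.ne.symm, hvb.ne.symm, Or.inr (Or.inl ⟨rfl, hvb⟩)⟩
    have hG' := (hG.contractInto hva.symm).contractInto hab'
    set I' := I.filter fun w => ¬ (a ∈ T w ∧ b ∈ T w) with hI'
    have hsplit := Finset.card_filter_add_card_filter_not (s := I) (fun w => a ∈ T w ∧ b ∈ T w)
    have haC := (hT v hv).1 ha
    have hbC := (hT v hv).1 hb
    have hCv : ∀ c ∈ C, c ∉ I := fun c hc hc' => Finset.disjoint_left.1 hCI hc hc'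
    have hcard : (C.erase b).card = m := by rw [Finset.card_erase_of_mem hbC]; omega
    have := ih _ hG' I' (C.erase b) (fun w => (T w).image fun c => if c = b then a else c)
      (Finset.disjoint_left.2 fun c hc hc' => hCv c (Finset.mem_of_mem_erase hc)
        (Finset.mem_filter.1 hc').1) (by
        intro w hw
        obtain ⟨hw, hnot⟩ := Finset.mem_filter.1 hw
        obtain ⟨h1, h2, h3⟩ := hT w hw
        refine ⟨?_, ?_, ?_⟩
        · intro c hc
          obtain ⟨d, hd, rfl⟩ := Finset.mem_image.1 hc
          split_ifs with h
          · exact Finset.mem_erase.2 ⟨hab, haC⟩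
          · exact Finset.mem_erase.2 ⟨h, h1 hd⟩
        · rw [Finset.card_image_of_injOn, h2]
          intro c hc d hd hcd
          simp only [Finset.mem_coe] at hc hd
          dsimp only at hcd
          split_ifs at hcd with e1 e2 e2
          · rw [e1, e2]
          · subst e1 hcd; exact absurd ⟨hd, hc⟩ hnot
          · subst e2 hcd; exact absurd ⟨hc, hd⟩ hnot
          · exact hcd
        · intro c hc
          obtain ⟨d, hd, rfl⟩ := Finset.mem_image.1 hc
          have hwv : w ≠ v := fun h => hnot (h ▸ ⟨ha, hb⟩)
          have hwd : (G.contractInto a v).Adj w d :=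
            ⟨(h3 d hd).ne, hwv, fun h => hCv d (h1 hd) (h ▸ hv), Or.inl (h3 d hd)⟩
          have hwb : w ≠ b := fun h => hCv b hbC (h ▸ hw)
          have hwa : w ≠ a := fun h => hCv a haC (h ▸ hw)
          split_ifs with h
          · subst h
            exact ⟨hwa, hwb, hab, Or.inr (Or.inr ⟨rfl, hwd.symm⟩)⟩
          · exact ⟨hwd.ne, hwb, h, Or.inl hwd⟩) hcard
    have hI'2 : (I.filter fun w => a ∈ T w ∧ b ∈ T w).card + I'.card = I.card := by
      rw [hI']; convert hsplit
    omega

open Classical in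
lemma card_le_of_pairs (hG : G.VanKampenTrivial) {I C : Finset V} {T : V → Finset V} {q : ℕ}
    (hCI : Disjoint C I) (hT : ∀ v ∈ I, T v ⊆ C ∧ (T v).card = 2 ∧ ∀ c ∈ T v, G.Adj v c)
    (hq : ∀ a b, a ≠ b → (I.filter fun v => T v = {a, b}).card ≤ q) :
    I.card ≤ q * (4 * C.card) := by
  rcases I.eq_empty_or_nonempty with rfl | ⟨v, hv⟩
  · simp
  have hC : C.Nonempty :=
    (Finset.card_pos.1 (by rw [(hT v hv).2.1]; omega : 0 < (T v).card)).mono (hT v hv).1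
  set H := SimpleGraph.cliqueReplacement I T with hH
  have hHG : H.VanKampenTrivial :=
    hG.cliqueReplacement hCI fun v hv => ⟨(hT v hv).1, by rw [(hT v hv).2.1]; omega, (hT v hv).2.2⟩
  have hlt := hHG.sum_degree_lt 3 C.card H 0 ∅ C rfl (by simp) (by simp) hC rfl
  have hdeg : ∀ x ∈ C, (I.filter fun v => x ∈ T v).card ≤ q * (C.filter (H.Adj x)).card := by
    intro x hx
    have hother : ∀ w, ∃ y, w ∈ I → x ∈ T w → y ∈ T w ∧ x ≠ y ∧ T w = {x, y} := by
      intro w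
      by_cases hw : w ∈ I ∧ x ∈ T w
      · obtain ⟨hw, hxw⟩ := hw
        obtain ⟨y, z, hyz, h⟩ := Finset.card_eq_two.1 (hT w hw).2.1
        rw [h] at hxw ⊢
        simp only [Finset.mem_insert, Finset.mem_singleton] at hxw
        rcases hxw with rfl | rfl
        · exact ⟨z, fun _ _ => ⟨by simp, hyz, rfl⟩⟩
        · exact ⟨y, fun _ _ => ⟨by simp, hyz.symm, Finset.pair_comm _ _⟩⟩
      · exact ⟨x, fun h1 h2 => absurd ⟨h1, h2⟩ hw⟩
    choose f hf using hother
    refine Finset.card_le_mul_card_image_of_maps_to (f := f) ?_ q ?_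
    · intro w hw
      obtain ⟨hw, hxw⟩ := Finset.mem_filter.1 hw
      obtain ⟨h1, h2, -⟩ := hf w hw hxw
      exact Finset.mem_filter.2 ⟨(hT w hw).1 h1, h2, w, hw, hxw, h1⟩
    · intro y hy
      refine (Finset.card_le_card ?_).trans (hq x y (Finset.mem_filter.1 hy).2.ne)
      intro w hw
      simp only [Finset.mem_filter] at hw ⊢
      exact ⟨hw.1.1, hw.2 ▸ (hf w hw.1.1 hw.1.2).2.2⟩
  have hcount : ∑ x ∈ C, (I.filter fun v => x ∈ T v).card = 2 * I.card := by
    have := Finset.sum_card_bipartiteAbove_eq_sum_card_bipartiteBelow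
      (s := C) (t := I) (fun x v => x ∈ T v)
    simp only [Finset.bipartiteAbove, Finset.bipartiteBelow] at this
    rw [this, Finset.sum_congr rfl (g := fun _ => 2), Finset.sum_const, smul_eq_mul, mul_comm]
    intro v hv
    rw [Finset.filter_mem_eq_inter, Finset.inter_eq_right.2 (hT v hv).1, (hT v hv).2.1]
  have hsum := Finset.sum_le_sum hdeg
  rw [hcount, ← Finset.mul_sum] at hsum
  have := hsum.trans (Nat.mul_le_mul_left q hlt.le)
  have h2 : q * (2 ^ 3 * C.card) = 2 * (q * (4 * C.card)) := by ring
  omega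

end SimpleGraph.VanKampenTrivial

namespace SimpleGraph

variable {V : Type} [Fintype V] (G : SimpleGraph V)

lemma exists_isMatching_forall_not_adj : ∃ M : G.Subgraph, M.IsMatching ∧
    ∀ u v, u ∉ M.verts → v ∉ M.verts → ¬ G.Adj u v := by
  obtain ⟨M, hM, hmax⟩ := (Set.toFinite {M : G.Subgraph | M.IsMatching}).exists_maximal
    ⟨⊥, fun v hv => absurd hv (by simp)⟩
  refine ⟨M, hM, fun u v hu hv huv => ?_⟩
  have hM' : (M ⊔ G.subgraphOfAdj huv).IsMatching := by
    refine Subgraph.IsMatching.sup hM (Subgraph.IsMatching.subgraphOfAdj huv) ?_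
    rw [hM.support_eq_verts, (Subgraph.IsMatching.subgraphOfAdj huv).support_eq_verts]
    refine Set.disjoint_left.2 fun w hw hw' => ?_
    simp only [subgraphOfAdj_verts, Set.mem_insert_iff, Set.mem_singleton_iff] at hw'
    rcases hw' with rfl | rfl <;> tauto
  have := (hmax hM' le_sup_left).1 (Or.inr (by simp) : u ∈ (M ⊔ G.subgraphOfAdj huv).verts)
  exact hu this

variable {G}

lemma Subgraph.IsMatching.ncard_verts_le {M : G.Subgraph} (hM : M.IsMatching) :
    M.verts.ncard ≤ 2 * M.edgeSet.ncard := by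
  classical
  have hfin := M.edgeSet.toFinite
  rw [Set.ncard_eq_toFinset_card _ hfin, mul_comm]
  have hsub : M.verts ⊆ ↑(hfin.toFinset.biUnion Sym2.toFinset) := by
    intro v hv
    obtain ⟨w, hw, -⟩ := hM hv
    simp only [Finset.coe_biUnion, Set.mem_iUnion, Finset.mem_coe, Set.Finite.mem_toFinset]
    exact ⟨s(v, w), hw, by simp⟩
  refine (Set.ncard_le_ncard hsub (Finset.finite_toSet _)).trans ?_
  rw [Set.ncard_coe_finset]
  refine Finset.card_biUnion_le_card_mul _ _ _ fun e _ => ?_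
  rw [Sym2.card_toFinset]
  split_ifs <;> omega

end SimpleGraph

/-- A connected planar graph on `n` vertices with minimum degree 2
and no `r`-family (`r ≥ 3`) has a matching of size at least `n/(12r − 3)`. -/
theorem matching_of_no_family {V : Type} [Fintype V] (G : SimpleGraph V)
    (r : ℕ) (hr : 3 ≤ r)
    (hconn : G.Connected) (hplanar : Nonempty (PlaneEmbedding G))
    (hdeg : ∀ v : V, 2 ≤ (G.neighborSet v).ncard)
    (hfam : ¬ ∃ R : Set V, IsRFamily G R r) :
    ∃ M : G.Subgraph, M.IsMatching ∧
      Fintype.card V ≤ (12 * r - 3) * M.edgeSet.ncard := by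
  classical
  obtain ⟨P⟩ := hplanar
  have hG := P.vanKampenTrivial
  obtain ⟨M, hM, hind⟩ := G.exists_isMatching_forall_not_adj
  refine ⟨M, hM, ?_⟩
  have hC2 := hM.ncard_verts_le
  rw [Set.ncard_eq_toFinset_card'] at hC2
  set C := M.verts.toFinset with hC
  have hmemC : ∀ v, v ∈ C ↔ v ∈ M.verts := fun v => Set.mem_toFinset
  have hdeg' : ∀ v, 2 ≤ (G.neighborFinset v).card := fun v => by
    rw [← Set.ncard_coe_finset, SimpleGraph.coe_neighborFinset]; exact hdeg v
  have hsub : ∀ v ∉ C, G.neighborFinset v ⊆ C := by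
    intro v hv c hc
    by_contra hc'
    rw [hmemC] at hv hc'
    exact hind v c hv hc' ((G.mem_neighborFinset v c).1 hc)
  set I₂ := Cᶜ.filter fun v => (G.neighborFinset v).card = 2 with hI₂
  set I₃ := Cᶜ.filter fun v => ¬ (G.neighborFinset v).card = 2 with hI₃
  have hsplit : I₂.card + I₃.card = Cᶜ.card := Finset.card_filter_add_card_filter_not _
  have htotal : C.card + Cᶜ.card = Fintype.card V := Finset.card_add_card_compl C
  have hdisj : ∀ I ⊆ Cᶜ, Disjoint C I := fun I hI =>
    Finset.disjoint_left.2 fun c hc hc' => Finset.mem_compl.1 (hI hc') hc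
  have hd₂ : Disjoint C I₂ := hdisj _ (Finset.filter_subset _ _)
  have hd₃ : Disjoint C I₃ := hdisj _ (Finset.filter_subset _ _)
  have h₂ : I₂.card ≤ (r - 1) * (4 * C.card) := by
    refine hG.card_le_of_pairs (T := fun v => G.neighborFinset v) hd₂
      (fun v hv => ?_) fun a b hab => ?_
    · obtain ⟨h1, h2⟩ := Finset.mem_filter.1 hv
      exact ⟨hsub v (Finset.mem_compl.1 h1), h2, fun c hc => (G.mem_neighborFinset v c).1 hc⟩
    · by_contra! hlt
      obtain ⟨R, hR, hRr⟩ := Finset.exists_subset_card_eq (by omega :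
        r ≤ (I₂.filter fun v => G.neighborFinset v = {a, b}).card)
      refine hfam ⟨R, by rw [Set.ncard_coe_finset, hRr], a, b, hab, fun v hv => ?_⟩
      have := (Finset.mem_filter.1 (hR hv)).2
      rw [← SimpleGraph.coe_neighborFinset, this, Finset.coe_pair]
  have h₃ : I₃.card ≤ 7 * C.card := by
    have htriple : ∀ v, ∃ t, v ∈ I₃ → t ⊆ G.neighborFinset v ∧ t.card = 3 := by
      intro v
      by_cases hv : v ∈ I₃
      · have h1 := (Finset.mem_filter.1 hv).2
        have h2 := hdeg' v
        obtain ⟨t, ht⟩ := Finset.exists_subset_card_eq (by omega : 3 ≤ (G.neighborFinset v).card)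
        exact ⟨t, fun _ => ht⟩
      · exact ⟨∅, fun h => absurd h hv⟩
    choose T hT using htriple
    refine SimpleGraph.VanKampenTrivial.card_le_seven_mul C.card G hG I₃ C T hd₃
      (fun v hv => ?_) rfl
    obtain ⟨h1, h2⟩ := hT v hv
    exact ⟨h1.trans (hsub v (Finset.mem_compl.1 (Finset.mem_filter.1 hv).1)), h2,
      fun c hc => (G.mem_neighborFinset v c).1 (h1 hc)⟩
  obtain ⟨r, rfl⟩ := Nat.exists_eq_add_of_le hr
  have e1 : 3 + r - 1 = r + 2 := by omega
  have e2 : 12 * (3 + r) - 3 = 12 * r + 33 := by omega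
  rw [e1] at h₂
  rw [e2]
  nlinarith
end

section
/- If G is a connected planar graph on n vertices with minimum degree 2 that contains no 3-family, then G has a matching of size at least n/33. -/
open Set Bornology

/-- A nowhere vanishing continuous function on a simply connected, locally path-connected space
has a continuous logarithm. -/
lemma exists_continuous_log {A : Type} [TopologicalSpace A] [SimplyConnectedSpace A]
    [LocallyPathConnectedSpace A] (f : C(A, ℂ)) (hf : ∀ x, f x ≠ 0) :
    ∃ ℓ : C(A, ℂ), ∀ x, Complex.exp (ℓ x) = f x := by
  obtain ⟨a⟩ : Nonempty A := inferInstance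
  obtain ⟨F, ⟨-, hF⟩, -⟩ := Complex.isCoveringMapOn_exp.existsUnique_continuousMap_lifts f
    (Complex.exp_log (hf a)) (fun x => hf x)
  exact ⟨F, fun x => congrFun hF x⟩

/-- Two continuous logarithms of the same path have the same increment. -/
lemma log_increment_unique (ℓ₁ ℓ₂ : C(ℝ, ℂ))
    (h : ∀ t, Complex.exp (ℓ₁ t) = Complex.exp (ℓ₂ t)) :
    ℓ₁ 1 - ℓ₁ 0 = ℓ₂ 1 - ℓ₂ 0 := by
  set c := ℓ₁ 0 - ℓ₂ 0 with hc
  have hc1 : Complex.exp c = 1 := by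
    rw [hc, Complex.exp_sub, h 0, div_self (Complex.exp_ne_zero _)]
  have key := Complex.isCoveringMapOn_exp.existsUnique_continuousMap_lifts
    (⟨fun t => Complex.exp (ℓ₁ t), by fun_prop⟩ : C(ℝ, ℂ)) (a₀ := 0) (e₀ := ℓ₁ 0) rfl
    (fun x => Complex.exp_ne_zero _)
  have h2 := key.unique (y₁ := ℓ₁) (y₂ := ⟨fun t => ℓ₂ t + c, by fun_prop⟩) ⟨rfl, rfl⟩
    ⟨by simp [hc], by
      funext t
      simp [Complex.exp_add, hc1, h t]⟩
  have h3 := DFunLike.congr_fun h2 1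
  simp only [ContinuousMap.coe_mk] at h3
  rw [h3]; ring

/-- The change of argument along each edge of a drawing, seen from each vertex, is recorded by
integers which are constrained by every pair of edges drawn disjointly. -/
lemma exists_winding {ι : Type} [LinearOrder ι] (p : ι → ℂ) (hp : Function.Injective p)
    (γ : ι → ι → C(ℝ, ℂ)) :
    ∃ n : ι → ι → ι → ℤ, ∀ a b c d, a ≠ c → a ≠ d → b ≠ c → b ≠ d →
      γ a b 0 = p a → γ a b 1 = p b → γ c d 0 = p c → γ c d 1 = p d →
      (∀ s t, γ a b s ≠ γ c d t) →
      2 * (n c a b + n b c d - n d a b - n a c d) + (if c < b then 1 else -1) +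
        (if a < c then 1 else -1) + (if b < d then 1 else -1) + (if d < a then 1 else -1)
        = (0 : ℤ) := by
  obtain ⟨φ, hφ, hφσ⟩ : ∃ φ : ι → ι → ℂ, (∀ v w, v ≠ w → Complex.exp (φ v w) = p w - p v) ∧
      ∀ v w, v ≠ w → φ v w - φ w v =
        Real.pi * Complex.I * ((if v < w then 1 else -1 : ℤ) : ℂ) := by
    refine ⟨fun v w => if v < w then Complex.log (p v - p w) + Real.pi * Complex.I
      else Complex.log (p w - p v), fun v w hvw => ?_, fun v w hvw => ?_⟩
    · have h1 : p v - p w ≠ 0 := sub_ne_zero.2 (hp.ne hvw)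
      have h2 : p w - p v ≠ 0 := sub_ne_zero.2 (hp.ne hvw.symm)
      by_cases h : v < w
      · simp [h, Complex.exp_add, Complex.exp_log h1]
      · simp [h, Complex.exp_log h2]
    · rcases lt_or_gt_of_ne hvw with h | h
      · simp [h, h.not_gt]
      · simp [h, h.not_gt]
  have key : ∀ v a b, ∃ n : ℤ, v ≠ a → v ≠ b → γ a b 0 = p a → γ a b 1 = p b →
      ∀ ℓ : C(ℝ, ℂ), (∀ t, Complex.exp (ℓ t) = γ a b t - p v) →
        ℓ 1 - ℓ 0 = φ v b - φ v a + n * (2 * Real.pi * Complex.I) := by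
    intro v a b
    by_cases h : v ≠ a ∧ v ≠ b ∧ γ a b 0 = p a ∧ γ a b 1 = p b ∧
        ∃ ℓ : C(ℝ, ℂ), ∀ t, Complex.exp (ℓ t) = γ a b t - p v
    · obtain ⟨hva, hvb, h0, h1, ℓ, hℓ⟩ := h
      have : Complex.exp (ℓ 1 - ℓ 0) = Complex.exp (φ v b - φ v a) := by
        rw [Complex.exp_sub, Complex.exp_sub, hℓ, hℓ, h0, h1, hφ _ _ hva, hφ _ _ hvb]
      obtain ⟨n, hn⟩ := Complex.exp_eq_exp_iff_exists_int.1 this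
      refine ⟨n, fun _ _ _ _ ℓ' hℓ' => ?_⟩
      rw [← hn]
      exact log_increment_unique _ _ fun t => by rw [hℓ, hℓ']
    · exact ⟨0, fun h1 h2 h3 h4 ℓ hℓ => absurd ⟨h1, h2, h3, h4, ℓ, hℓ⟩ h⟩
  choose n hn using key
  refine ⟨n, fun a b c d hac had hbc hbd ha hb hc hd hdisj => ?_⟩
  obtain ⟨L, hL⟩ := exists_continuous_log (A := ℝ × ℝ)
    ⟨fun x => γ a b x.1 - γ c d x.2, by fun_prop⟩ (fun x => sub_ne_zero.2 (hdisj _ _))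
  simp only [ContinuousMap.coe_mk] at hL
  have h1 := hn c a b hac.symm hbc.symm ha hb ⟨fun t => L (t, 0), by fun_prop⟩
    (fun t => by simp [hL, hc])
  have h2 := hn d a b had.symm hbd.symm ha hb ⟨fun t => L (t, 1), by fun_prop⟩
    (fun t => by simp [hL, hd])
  have h3 := hn a c d hac had hc hd ⟨fun t => L (0, t) + Real.pi * Complex.I, by fun_prop⟩
    (fun t => by simp [hL, ha, Complex.exp_add])
  have h4 := hn b c d hbc hbd hc hd ⟨fun t => L (1, t) + Real.pi * Complex.I, by fun_prop⟩
    (fun t => by simp [hL, hb, Complex.exp_add])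
  simp only [ContinuousMap.coe_mk] at h1 h2 h3 h4
  have e1 := hφσ c b hbc.symm
  have e2 := hφσ a c hac
  have e3 := hφσ b d hbd
  have e4 := hφσ d a had.symm
  have hpi : (Real.pi * Complex.I : ℂ) ≠ 0 := by simp [Real.pi_ne_zero]
  apply (Int.cast_injective (α := ℂ))
  apply mul_left_cancel₀ hpi
  push_cast at e1 e2 e3 e4 ⊢
  linear_combination -e1 - e2 - e3 - e4 - h1 + h2 + h3 - h4

/-- `H` is a minor of `G`: there are disjoint connected branch sets in `G`, one for each vertex
of `H`, with an edge of `G` between the branch sets of adjacent vertices. Branch sets of isolated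
vertices may be empty. -/
def IsGraphMinor {W V : Type} (H : SimpleGraph W) (G : SimpleGraph V) : Prop :=
  ∃ B : W → Set V, (∀ i j, i ≠ j → Disjoint (B i) (B j)) ∧
    (∀ i, (G.induce (B i)).Preconnected) ∧
    ∀ i j, H.Adj i j → ∃ x ∈ B i, ∃ y ∈ B j, G.Adj x y

namespace PlaneEmbedding

variable {V : Type} {G : SimpleGraph V}

lemma joinedIn_subImage_of_adj (P : PlaneEmbedding G) {S : Set V} {u v : V} (hu : u ∈ S)
    (hv : v ∈ S) (h : G.Adj u v) : JoinedIn (P.subImage S) (P.pos u) (P.pos v) := by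
  obtain ⟨a, b, hab, γ, -, hγ⟩ := P.arc_path ⟨s(u, v), h⟩
  have hsub : P.arc ⟨s(u, v), h⟩ ⊆ P.subImage S := by
    intro x hx
    refine Or.inr (Set.mem_biUnion (x := ⟨s(u, v), h⟩) ?_ hx)
    intro w hw
    rcases Sym2.mem_iff.1 hw with rfl | rfl <;> assumption
  have hJ : JoinedIn (P.subImage S) (P.pos a) (P.pos b) :=
    ⟨γ, fun t => hsub (hγ ▸ Set.mem_range_self t)⟩
  rcases Sym2.eq_iff.1 hab with ⟨rfl, rfl⟩ | ⟨rfl, rfl⟩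
  · exact hJ
  · exact hJ.symm

lemma joinedIn_subImage (P : PlaneEmbedding G) {S : Set V} (hS : (G.induce S).Preconnected)
    {u v : V} (hu : u ∈ S) (hv : v ∈ S) :
    JoinedIn (P.subImage S) (P.pos u) (P.pos v) := by
  obtain ⟨w⟩ := hS ⟨u, hu⟩ ⟨v, hv⟩
  suffices ∀ x y : S, (G.induce S).Walk x y → JoinedIn (P.subImage S) (P.pos x) (P.pos y) from
    this _ _ w
  intro x y w
  induction w with
  | nil => exact JoinedIn.refl (Or.inl (Set.mem_image_of_mem _ (Subtype.coe_prop _)))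
  | cons h _ ih =>
    exact (P.joinedIn_subImage_of_adj (Subtype.coe_prop _) (Subtype.coe_prop _) h).trans ih

lemma disjoint_subImage (P : PlaneEmbedding G) {S S' : Set V} (h : Disjoint S S') :
    Disjoint (P.subImage S) (P.subImage S') := by
  rw [Set.disjoint_left] at h ⊢
  rintro x (⟨v, hv, rfl⟩ | hx) hx'
  · rcases hx' with ⟨v', hv', hvv⟩ | hx'
    · exact h hv (P.pos_inj hvv ▸ hv')
    · obtain ⟨e, he, hx'⟩ := Set.mem_iUnion₂.1 hx'
      exact h hv (he _ (P.arc_avoid e v hx'))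
  · obtain ⟨e, he, hx⟩ := Set.mem_iUnion₂.1 hx
    rcases hx' with ⟨v', hv', rfl⟩ | hx'
    · exact h (he _ (P.arc_avoid e v' hx)) hv'
    · obtain ⟨e', he', hx'⟩ := Set.mem_iUnion₂.1 hx'
      have hne : e ≠ e' := by
        rintro rfl
        obtain ⟨⟨u, v⟩, huv⟩ := e
        exact h (he u (Sym2.mem_mk_left _ _)) (he' u (Sym2.mem_mk_left _ _))
      obtain ⟨w, hw, hw', -⟩ := P.arc_inter e e' hne x ⟨hx, hx'⟩
      exact h (he _ hw) (he' _ hw')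

end PlaneEmbedding

/-- A minor of a plane graph without isolated vertices has a drawing in the plane in which
vertex-disjoint edges do not meet; the drawing determines winding integers. -/
lemma PlaneEmbedding.exists_winding_of_isGraphMinor {V ι : Type} [LinearOrder ι]
    {G : SimpleGraph V} (P : PlaneEmbedding G) {K : SimpleGraph ι} (hK : ∀ i, ∃ j, K.Adj i j)
    (hm : IsGraphMinor K G) :
    ∃ n : ι → ι → ι → ℤ, ∀ a b c d, a ≠ c → a ≠ d → b ≠ c → b ≠ d → K.Adj a b → K.Adj c d →
      2 * (n c a b + n b c d - n d a b - n a c d) + (if c < b then 1 else -1) +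
        (if a < c then 1 else -1) + (if b < d then 1 else -1) + (if d < a then 1 else -1)
        = (0 : ℤ) := by
  obtain ⟨B, hdisj, hconn, hadj⟩ := hm
  have hne : ∀ i, ∃ x, x ∈ B i := fun i => by
    obtain ⟨j, hj⟩ := hK i
    obtain ⟨x, hx, -⟩ := hadj i j hj
    exact ⟨x, hx⟩
  choose r hr using hne
  let F := Complex.equivRealProdCLM.symm
  have hpath : ∀ i j, ∃ γ : C(ℝ, ℂ), K.Adj i j → γ 0 = F (P.pos (r i)) ∧
      γ 1 = F (P.pos (r j)) ∧ ∀ t, F.symm (γ t) ∈ P.subImage (B i ∪ B j) := by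
    intro i j
    by_cases h : K.Adj i j
    · obtain ⟨x, hx, y, hy, hxy⟩ := hadj i j h
      obtain ⟨γ, hγ⟩ := P.joinedIn_subImage
        (SimpleGraph.connected_induce_union (hconn i) (hconn j) hx hy hxy).preconnected
        (Or.inl (hr i)) (Or.inr (hr j))
      refine ⟨⟨fun t => F (γ.extend t), by fun_prop⟩, fun _ => ⟨by simp, by simp, fun t => ?_⟩⟩
      simp only [ContinuousMap.coe_mk, ContinuousLinearEquiv.symm_apply_apply]
      have : γ.extend t ∈ Set.range γ := by
        rw [← γ.extend_range]; exact Set.mem_range_self _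
      obtain ⟨s, hs⟩ := this
      exact hs ▸ hγ s
    · exact ⟨0, fun h' => absurd h' h⟩
  choose γ hγ using hpath
  have hinj : Function.Injective fun i => F (P.pos (r i)) := by
    intro i j hij
    by_contra hne
    have h1 : r i = r j := P.pos_inj (F.injective hij)
    exact Set.disjoint_left.1 (hdisj i j hne) (hr i) (h1 ▸ hr j)
  obtain ⟨n, hn⟩ := exists_winding _ hinj γ
  refine ⟨n, fun a b c d hac had hbc hbd hab hcd => ?_⟩
  obtain ⟨h0, h1, h2⟩ := hγ a b hab
  obtain ⟨h0', h1', h2'⟩ := hγ c d hcd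
  refine hn a b c d hac had hbc hbd h0 h1 h0' h1' fun s t hst => ?_
  refine Set.disjoint_left.1 (P.disjoint_subImage (S := B a ∪ B b) (S' := B c ∪ B d) ?_)
    (h2 s) (hst ▸ h2' t)
  simp [hdisj, hac, had, hbc, hbd]

/-- A plane graph has no `K₅` minor. -/
lemma PlaneEmbedding.not_isGraphMinor_completeGraph_five {V : Type} {G : SimpleGraph V}
    (P : PlaneEmbedding G) : ¬ IsGraphMinor (⊤ : SimpleGraph (Fin 5)) G := by
  intro hm
  obtain ⟨n, hn⟩ := P.exists_winding_of_isGraphMinor (by decide) hm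
  have h1 := hn 0 1 2 3
  have h2 := hn 0 1 2 4
  have h3 := hn 0 1 3 4
  have h4 := hn 0 2 1 3
  have h5 := hn 0 2 1 4
  have h6 := hn 0 2 3 4
  have h7 := hn 0 3 1 2
  have h8 := hn 0 3 1 4
  have h9 := hn 0 3 2 4
  have h10 := hn 0 4 1 2
  have h11 := hn 0 4 1 3
  have h12 := hn 0 4 2 3
  have h13 := hn 1 2 3 4
  have h14 := hn 1 3 2 4
  have h15 := hn 1 4 2 3
  simp only [SimpleGraph.top_adj] at *
  simp [-mul_eq_zero] at h1 h2 h3 h4 h5 h6 h7 h8 h9 h10 h11 h12 h13 h14 h15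
  omega

/-- A plane graph does not contain `K₃,₃`. -/
lemma PlaneEmbedding.false_of_common_neighbors {V : Type} {G : SimpleGraph V}
    (P : PlaneEmbedding G) (x y : Fin 3 → V) (hx : Function.Injective x)
    (hy : Function.Injective y) (h : ∀ i j, G.Adj (x i) (y j)) : False := by
  have hxy : ∀ i j, x i ≠ y j := fun i j => (h i j).ne
  let f : Fin 3 ⊕ Fin 3 → V := Sum.elim x y
  have hf : Function.Injective f := hx.sumElim hy hxy
  have hm : IsGraphMinor (SimpleGraph.fromRel fun i j : Fin 6 => i < 3 ∧ 3 ≤ j) G := by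
    refine ⟨fun i => {f (finSumFinEquiv.symm i)}, fun i j hij => ?_, fun i => ?_, ?_⟩
    · simpa using hf.ne (finSumFinEquiv.symm.injective.ne hij)
    · rintro ⟨_, rfl⟩ ⟨_, rfl⟩
      rfl
    · intro i j hij
      refine ⟨_, rfl, _, rfl, ?_⟩
      have key : ∀ i j : Fin 3 ⊕ Fin 3, finSumFinEquiv i < (3 : Fin 6) →
          (3 : Fin 6) ≤ finSumFinEquiv j → G.Adj (f i) (f j) := by
        have hl : ∀ i : Fin 3, ¬ (3 : Fin 6) ≤ finSumFinEquiv (m := 3) (n := 3) (Sum.inl i) := by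
          decide
        have hr : ∀ i : Fin 3, ¬ finSumFinEquiv (m := 3) (n := 3) (Sum.inr i) < (3 : Fin 6) := by
          decide
        rintro (i | i) (j | j) hi hj
        · exact absurd hj (hl j)
        · exact h i j
        · exact absurd hi (hr i)
        · exact absurd hi (hr i)
      obtain ⟨-, ⟨hi, hj⟩ | ⟨hj, hi⟩⟩ := hij
      · exact key _ _ (by simpa using hi) (by simpa using hj)
      · exact (key _ _ (by simpa using hj) (by simpa using hi)).symm
  obtain ⟨n, hn⟩ := P.exists_winding_of_isGraphMinor (by
    simp only [SimpleGraph.fromRel_adj]; decide) hm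
  have h1 := hn 0 3 1 4
  have h2 := hn 0 3 1 5
  have h3 := hn 0 3 2 4
  have h4 := hn 0 3 2 5
  have h5 := hn 0 4 1 3
  have h6 := hn 0 4 1 5
  have h7 := hn 0 4 2 3
  have h8 := hn 0 4 2 5
  have h9 := hn 0 5 1 3
  have h10 := hn 0 5 1 4
  have h11 := hn 0 5 2 3
  have h12 := hn 0 5 2 4
  have h13 := hn 1 3 2 4
  have h14 := hn 1 3 2 5
  have h15 := hn 1 4 2 3
  have h16 := hn 1 4 2 5
  have h17 := hn 1 5 2 3
  have h18 := hn 1 5 2 4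
  simp [-mul_eq_zero] at h1 h2 h3 h4 h5 h6 h7 h8 h9 h10 h11 h12 h13 h14 h15 h16 h17 h18
  omega

namespace IsGraphMinor

variable {U W V : Type}

lemma mono {K : SimpleGraph U} {G G' : SimpleGraph V} (h : IsGraphMinor K G) (hG : G ≤ G') :
    IsGraphMinor K G' := by
  obtain ⟨B, hd, hc, ha⟩ := h
  refine ⟨B, hd, fun i => (hc i).mono fun _ _ hxy => hG hxy, fun i j hij => ?_⟩
  obtain ⟨x, hx, y, hy, hxy⟩ := ha i j hij
  exact ⟨x, hx, y, hy, hG hxy⟩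

lemma trans {K : SimpleGraph U} {H : SimpleGraph W} {G : SimpleGraph V}
    (h : IsGraphMinor K H) (h' : IsGraphMinor H G) : IsGraphMinor K G := by
  obtain ⟨C, hCd, hCc, hCa⟩ := h
  obtain ⟨B, hBd, hBc, hBa⟩ := h'
  refine ⟨fun i => ⋃ w ∈ C i, B w, fun i j hij => ?_, fun i => ?_, fun i j hij => ?_⟩
  · rw [Set.disjoint_left]
    intro x hx hx'
    obtain ⟨w, hw, hx⟩ := Set.mem_iUnion₂.1 hx
    obtain ⟨w', hw', hx'⟩ := Set.mem_iUnion₂.1 hx'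
    by_cases hww : w = w'
    · exact Set.disjoint_left.1 (hCd i j hij) hw (hww ▸ hw')
    · exact Set.disjoint_left.1 (hBd w w' hww) hx hx'
  · have hsub : ∀ w ∈ C i, B w ⊆ ⋃ w ∈ C i, B w := fun w hw => Set.subset_biUnion_of_mem hw
    have hB : ∀ w (hw : w ∈ C i) x y (hx : x ∈ B w) (hy : y ∈ B w),
        (G.induce (⋃ w ∈ C i, B w)).Reachable ⟨x, hsub w hw hx⟩ ⟨y, hsub w hw hy⟩ :=
      fun w hw x y hx hy =>
        (hBc w ⟨x, hx⟩ ⟨y, hy⟩).map (SimpleGraph.induceHomOfLE G (hsub w hw)).toHom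
    have hwalk : ∀ w w' : C i, (H.induce (C i)).Walk w w' → ∀ x y (hx : x ∈ B w) (hy : y ∈ B w'),
        (G.induce (⋃ w ∈ C i, B w)).Reachable ⟨x, hsub w w.2 hx⟩ ⟨y, hsub w' w'.2 hy⟩ := by
      intro w w' p
      induction p with
      | nil => exact fun x y hx hy => hB _ (Subtype.coe_prop _) x y hx hy
      | @cons u v w hadj _ ih =>
        intro x y hx hy
        obtain ⟨s, hs, t, ht, hst⟩ := hBa u v hadj
        refine (hB u u.2 x s hx hs).trans (SimpleGraph.Reachable.trans ?_ (ih t y ht hy))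
        exact SimpleGraph.Adj.reachable (by simpa using hst)
    rintro ⟨x, hx⟩ ⟨y, hy⟩
    obtain ⟨w, hw, hxw⟩ := Set.mem_iUnion₂.1 hx
    obtain ⟨w', hw', hyw⟩ := Set.mem_iUnion₂.1 hy
    obtain ⟨p⟩ := hCc i ⟨w, hw⟩ ⟨w', hw'⟩
    exact hwalk _ _ p x y hxw hyw
  · obtain ⟨w, hw, w', hw', hadj⟩ := hCa i j hij
    obtain ⟨x, hx, y, hy, hxy⟩ := hBa w w' hadj
    exact ⟨x, Set.mem_biUnion hw hx, y, Set.mem_biUnion hw' hy, hxy⟩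

/-- A `K₄` together with a disjoint connected set meeting the neighborhood of each of its
vertices yields a `K₅` minor. -/
lemma completeGraph_five {G : SimpleGraph V} {x a b c : V} {D : Set V}
    (hxa : G.Adj x a) (hxb : G.Adj x b) (hxc : G.Adj x c) (hab : G.Adj a b) (hac : G.Adj a c)
    (hbc : G.Adj b c) (hD : (G.induce D).Preconnected)
    (hx : x ∉ D ∧ ∃ y ∈ D, G.Adj x y) (ha : a ∉ D ∧ ∃ y ∈ D, G.Adj a y)
    (hb : b ∉ D ∧ ∃ y ∈ D, G.Adj b y) (hc : c ∉ D ∧ ∃ y ∈ D, G.Adj c y) :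
    IsGraphMinor (⊤ : SimpleGraph (Fin 5)) G := by
  have hsing : ∀ z : V, (G.induce {z}).Preconnected := by
    rintro z ⟨_, rfl⟩ ⟨_, rfl⟩
    rfl
  suffices h : ∀ i j : Fin 5, i < j →
      Disjoint (![{x}, {a}, {b}, {c}, D] i) (![{x}, {a}, {b}, {c}, D] j) ∧
      ∃ u ∈ ![{x}, {a}, {b}, {c}, D] i, ∃ v ∈ ![{x}, {a}, {b}, {c}, D] j, G.Adj u v by
    refine ⟨![{x}, {a}, {b}, {c}, D], fun i j hij => ?_, fun i => ?_, fun i j hij => ?_⟩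
    · rcases lt_or_gt_of_ne hij with h' | h'
      · exact (h i j h').1
      · exact (h j i h').1.symm
    · fin_cases i
      · exact hsing x
      · exact hsing a
      · exact hsing b
      · exact hsing c
      · exact hD
    · rcases lt_or_gt_of_ne (SimpleGraph.top_adj _ _ |>.1 hij) with h' | h'
      · exact (h i j h').2
      · obtain ⟨u, hu, v, hv, huv⟩ := (h j i h').2
        exact ⟨v, hv, u, hu, huv.symm⟩
  have hs : ∀ u v : V, G.Adj u v → Disjoint ({u} : Set V) {v} ∧
      ∃ s ∈ ({u} : Set V), ∃ t ∈ ({v} : Set V), G.Adj s t := fun u v h =>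
    ⟨by simpa using h.ne, u, rfl, v, rfl, h⟩
  have hsD : ∀ u : V, (u ∉ D ∧ ∃ y ∈ D, G.Adj u y) → Disjoint ({u} : Set V) D ∧
      ∃ s ∈ ({u} : Set V), ∃ t ∈ D, G.Adj s t := fun u h =>
    ⟨by simpa using h.1, u, rfl, h.2⟩
  intro i j hij
  fin_cases i <;> fin_cases j <;> first
    | exact absurd hij (by decide)
    | exact hs _ _ (by assumption)
    | exact hsD _ (by assumption)

/-- A vertex with four or five neighbors, each adjacent to at least three of the others, gives a
`K₅` minor. -/
lemma completeGraph_five_of_dense_neighborhood [DecidableEq V] {G : SimpleGraph V} {x : V}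
    (N : Finset V) (hN : ∀ y ∈ N, G.Adj x y) (hcard : N.card = 4 ∨ N.card = 5)
    (hdense : ∀ y ∈ N, ∃ T ⊆ N, (∀ z ∈ T, G.Adj y z) ∧ 3 ≤ T.card) :
    IsGraphMinor (⊤ : SimpleGraph (Fin 5)) G := by
  rcases hcard with hcard | hcard
  · let f : Fin 4 → V := fun i => (N.equivFinOfCardEq hcard).symm i
    have hf : Function.Injective f :=
      Subtype.val_injective.comp (N.equivFinOfCardEq hcard).symm.injective
    have hfN : ∀ i, f i ∈ N := fun i => Subtype.coe_prop _
    have hadj : ∀ i j, i ≠ j → G.Adj (f i) (f j) := by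
      intro i j hij
      by_contra hnot
      obtain ⟨T, hTN, hT, hT3⟩ := hdense _ (hfN i)
      have hsub : T ⊆ N \ {f i, f j} := by
        intro z hz
        simp only [Finset.mem_sdiff, Finset.mem_insert, Finset.mem_singleton, not_or]
        refine ⟨hTN hz, ?_, ?_⟩ <;> rintro rfl
        · exact (hT _ hz).ne rfl
        · exact hnot (hT _ hz)
      have h1 := Finset.card_le_card hsub
      rw [Finset.card_sdiff_of_subset (by simp [Finset.insert_subset_iff, hfN]),
        Finset.card_pair (hf.ne hij)] at h1
      omega
    refine completeGraph_five (x := x) (a := f 0) (b := f 1) (c := f 2) (D := {f 3})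
      (hN _ (hfN _)) (hN _ (hfN _)) (hN _ (hfN _)) (hadj _ _ (by decide)) (hadj _ _ (by decide))
      (hadj _ _ (by decide)) ?_ ?_ ?_ ?_ ?_
    · rintro ⟨_, rfl⟩ ⟨_, rfl⟩
      rfl
    · exact ⟨(hN _ (hfN _)).ne, _, rfl, hN _ (hfN _)⟩
    all_goals exact ⟨hf.ne (by decide), _, rfl, hadj _ _ (by decide)⟩
  · let f : Fin 5 → V := fun i => (N.equivFinOfCardEq hcard).symm i
    have hf : Function.Injective f :=
      Subtype.val_injective.comp (N.equivFinOfCardEq hcard).symm.injective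
    have hfN : ∀ i, f i ∈ N := fun i => Subtype.coe_prop _
    have hadj : ∀ i j k, i ≠ j → i ≠ k → j ≠ k → G.Adj (f i) (f j) ∨ G.Adj (f i) (f k) := by
      intro i j k hij hik hjk
      by_contra! hnot
      obtain ⟨T, hTN, hT, hT3⟩ := hdense _ (hfN i)
      have hsub : T ⊆ N \ {f i, f j, f k} := by
        intro z hz
        simp only [Finset.mem_sdiff, Finset.mem_insert, Finset.mem_singleton, not_or]
        refine ⟨hTN hz, ?_, ?_, ?_⟩ <;> rintro rfl
        · exact (hT _ hz).ne rfl
        · exact hnot.1 (hT _ hz)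
        · exact hnot.2 (hT _ hz)
      have h1 := Finset.card_le_card hsub
      rw [Finset.card_sdiff_of_subset (by simp [Finset.insert_subset_iff, hfN]),
        Finset.card_eq_three.2 ⟨_, _, _, hf.ne hij, hf.ne hik, hf.ne hjk, rfl⟩] at h1
      omega
    have hmk : ∀ a b c d e : Fin 5, a ≠ d → a ≠ e → b ≠ d → b ≠ e → c ≠ d → c ≠ e → d ≠ e →
        G.Adj (f a) (f b) → G.Adj (f a) (f c) → G.Adj (f b) (f c) → G.Adj (f d) (f e) →
        IsGraphMinor (⊤ : SimpleGraph (Fin 5)) G := by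
      intro a b c d e had hae hbd hbe hcd hce hde hab hac hbc hdadj
      refine completeGraph_five (x := x) (D := {f d, f e}) (hN _ (hfN a)) (hN _ (hfN b))
        (hN _ (hfN c)) hab hac hbc ?_ ?_ ?_ ?_ ?_
      · exact (SimpleGraph.induce_pair_connected_of_adj hdadj).preconnected
      · exact ⟨by simp [(hN _ (hfN _)).ne], _, Or.inl rfl, hN _ (hfN _)⟩
      · exact ⟨by simp [hf.ne had, hf.ne hae], by simpa using hadj _ _ _ had hae hde⟩
      · exact ⟨by simp [hf.ne hbd, hf.ne hbe], by simpa using hadj _ _ _ hbd hbe hde⟩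
      · exact ⟨by simp [hf.ne hcd, hf.ne hce], by simpa using hadj _ _ _ hcd hce hde⟩
    have hadj' : ∀ i j k, i ≠ j → i ≠ k → j ≠ k → ¬ G.Adj (f i) (f j) → G.Adj (f i) (f k) :=
      fun i j k h1 h2 h3 h => (hadj i j k h1 h2 h3).resolve_left h
    have hnon : ∀ a b c d e : Fin 5, a ≠ b → a ≠ c → a ≠ d → a ≠ e → b ≠ c → b ≠ d → b ≠ e →
        c ≠ d → c ≠ e → d ≠ e → ¬ G.Adj (f a) (f b) →
        IsGraphMinor (⊤ : SimpleGraph (Fin 5)) G := by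
      intro a b c d e hab hac had hae hbc hbd hbe hcd hce hde h
      have h' : ¬ G.Adj (f b) (f a) := fun h' => h h'.symm
      have h1 := hadj' a b c hab hac hbc h
      have h2 := hadj' a b d hab had hbd h
      have h3 := hadj' a b e hab hae hbe h
      have h5 := hadj' b a d hab.symm hbd had h'
      have h6 := hadj' b a e hab.symm hbe hae h'
      rcases hadj c d e hcd hce hde with h7 | h7
      · exact hmk a c d b e hab hae hbc.symm hce hbd.symm hde hbe h1 h2 h7 h6
      · exact hmk a c e b d hab had hbc.symm hcd hbe.symm hde.symm hbd h1 h3 h7 h5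
    by_cases h01 : G.Adj (f 0) (f 1)
    · by_cases h02 : G.Adj (f 0) (f 2)
      · by_cases h12 : G.Adj (f 1) (f 2)
        · by_cases h34 : G.Adj (f 3) (f 4)
          · exact hmk 0 1 2 3 4 (by decide) (by decide) (by decide) (by decide) (by decide)
              (by decide) (by decide) h01 h02 h12 h34
          · exact hnon 3 4 0 1 2 (by decide) (by decide) (by decide) (by decide) (by decide)
              (by decide) (by decide) (by decide) (by decide) (by decide) h34
        · exact hnon 1 2 0 3 4 (by decide) (by decide) (by decide) (by decide) (by decide)
              (by decide) (by decide) (by decide) (by decide) (by decide) h12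
      · exact hnon 0 2 1 3 4 (by decide) (by decide) (by decide) (by decide) (by decide)
              (by decide) (by decide) (by decide) (by decide) (by decide) h02
    · exact hnon 0 1 2 3 4 (by decide) (by decide) (by decide) (by decide) (by decide)
              (by decide) (by decide) (by decide) (by decide) (by decide) h01

end IsGraphMinor

section Density

variable {V : Type} [Fintype V]

open Classical in
lemma ncard_edgeSet_deleteIncidenceSet (H : SimpleGraph V) (x : V) :
    (H.deleteIncidenceSet x).edgeSet.ncard + H.degree x = H.edgeSet.ncard := by
  have h1 := H.card_edgeFinset_deleteIncidenceSet x
  have h2 : H.degree x ≤ H.edgeFinset.card := by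
    rw [← H.card_incidenceFinset_eq_degree]
    exact Finset.card_le_card (H.incidenceFinset_subset x)
  rw [← SimpleGraph.coe_edgeFinset, ← SimpleGraph.coe_edgeFinset, Set.ncard_coe_finset,
    Set.ncard_coe_finset]
  omega

open Classical in
/-- Contracting the edge `xy` onto `y` loses one edge plus one for each common neighbor. -/
lemma exists_contraction {H : SimpleGraph V} {x y : V} (hxy : H.Adj x y) :
    ∃ H' : SimpleGraph V, (∀ a b, H'.Adj a b → a ≠ x ∧ ∃ c, H.Adj a c) ∧ IsGraphMinor H' H ∧
      H.edgeSet.ncard ≤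
        H'.edgeSet.ncard + 1 + (H.neighborFinset x ∩ H.neighborFinset y).card := by
  set Z : Finset V := H.neighborFinset x \ (insert y (H.neighborFinset y)) with hZ
  have hZmem : ∀ z, z ∈ Z ↔ H.Adj x z ∧ z ≠ y ∧ ¬ H.Adj y z := by
    intro z; simp [hZ]
  refine ⟨H.deleteIncidenceSet x ⊔ SimpleGraph.fromEdgeSet ((fun z => s(y, z)) '' (Z : Set V)),
    ?_, ?_, ?_⟩
  · rintro a b (h | h)
    · rw [SimpleGraph.deleteIncidenceSet_adj] at h
      exact ⟨h.2.1, b, h.1⟩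
    · rw [SimpleGraph.fromEdgeSet_adj] at h
      obtain ⟨⟨z, hz, hzab⟩, -⟩ := h
      have hz' := (hZmem z).1 hz
      rcases Sym2.eq_iff.1 hzab with ⟨rfl, rfl⟩ | ⟨rfl, rfl⟩
      · exact ⟨hxy.ne', x, hxy.symm⟩
      · exact ⟨hz'.1.ne', x, hz'.1.symm⟩
  · refine ⟨fun a => if a = x then ∅ else if a = y then {x, y} else {a}, ?_, ?_, ?_⟩
    · intro i j hij
      rw [Set.disjoint_left]
      intro z
      have := hxy.ne
      dsimp only
      split_ifs <;> simp only [Set.mem_empty_iff_false, Set.mem_insert_iff,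
        Set.mem_singleton_iff] <;> grind
    · intro i
      have key : ∀ X : Set V, X = ∅ ∨ X = {x, y} ∨ X = {i} → (H.induce X).Preconnected := by
        rintro X (rfl | rfl | rfl)
        · rintro ⟨_, h⟩
          exact absurd h (Set.notMem_empty _)
        · exact (SimpleGraph.induce_pair_connected_of_adj hxy).preconnected
        · rintro ⟨_, rfl⟩ ⟨_, rfl⟩
          rfl
      exact key _ (by dsimp only; split_ifs <;> simp)
    · have hself : ∀ a, a ≠ x →
          a ∈ (if a = x then ∅ else if a = y then {x, y} else {a} : Set V) := by
        intro a ha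
        rw [if_neg ha]
        split_ifs with h <;> simp [h]
      have hx : x ∈ (if y = x then ∅ else if y = y then {x, y} else {y} : Set V) := by
        simp [hxy.ne']
      rintro a b (h | h)
      · rw [SimpleGraph.deleteIncidenceSet_adj] at h
        exact ⟨a, hself a h.2.1, b, hself b h.2.2, h.1⟩
      · rw [SimpleGraph.fromEdgeSet_adj] at h
        obtain ⟨⟨z, hz, hzab⟩, -⟩ := h
        have hz' := (hZmem z).1 hz
        rcases Sym2.eq_iff.1 hzab with ⟨rfl, rfl⟩ | ⟨rfl, rfl⟩
        · exact ⟨x, hx, z, hself z hz'.1.ne', hz'.1⟩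
        · exact ⟨z, hself z hz'.1.ne', x, hx, hz'.1.symm⟩
  · have hinj : Function.Injective fun z => s(y, z) := fun a b h => Sym2.congr_right.1 h
    have hcardZ : H.degree x ≤ Z.card + 1 +
        (H.neighborFinset x ∩ H.neighborFinset y).card := by
      rw [← SimpleGraph.card_neighborFinset_eq_degree]
      have hsub : H.neighborFinset x ⊆
          (Z ∪ {y}) ∪ (H.neighborFinset x ∩ H.neighborFinset y) := by
        intro z hz
        simp only [Finset.mem_union, Finset.mem_inter, hZmem, Finset.mem_singleton,
          SimpleGraph.mem_neighborFinset] at hz ⊢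
        tauto
      calc _ ≤ _ := Finset.card_le_card hsub
        _ ≤ _ := (Finset.card_union_le _ _).trans
          (Nat.add_le_add_right (Finset.card_union_le _ _) _)
    have hdisj : Disjoint (H.deleteIncidenceSet x).edgeSet ((fun z => s(y, z)) '' (Z : Set V)) := by
      rw [Set.disjoint_left]
      rintro _ h ⟨z, hz, rfl⟩
      rw [SimpleGraph.mem_edgeSet, SimpleGraph.deleteIncidenceSet_adj] at h
      exact ((hZmem z).1 hz).2.2 h.1
    have hle : (H.deleteIncidenceSet x).edgeSet ∪ ((fun z => s(y, z)) '' (Z : Set V)) ⊆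
        (H.deleteIncidenceSet x ⊔
          SimpleGraph.fromEdgeSet ((fun z => s(y, z)) '' (Z : Set V))).edgeSet := by
      rw [SimpleGraph.edgeSet_sup, SimpleGraph.edgeSet_fromEdgeSet]
      refine Set.union_subset_union_right _ fun e he => ⟨he, ?_⟩
      obtain ⟨z, hz, rfl⟩ := he
      simpa using ((hZmem z).1 hz).2.1.symm
    have h1 := Set.ncard_le_ncard hle (Set.toFinite _)
    rw [Set.ncard_union_eq hdisj (Set.toFinite _) (Set.toFinite _),
      Set.ncard_image_of_injective _ hinj, Set.ncard_coe_finset] at h1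
    have h2 := ncard_edgeSet_deleteIncidenceSet H x
    omega

open Classical in
/-- If a graph has fewer than `3 * #S` edges, some vertex of `S` has degree
at most five. -/
lemma exists_degree_le_five {H : SimpleGraph V} {S : Finset V}
    (hcard : H.edgeSet.ncard < 3 * S.card) :
    ∃ x ∈ S, H.degree x ≤ 5 := by
  by_contra! h
  have h1 : S.card * 6 ≤ ∑ x ∈ S, H.degree x := by
    rw [← smul_eq_mul]
    exact Finset.card_nsmul_le_sum _ _ _ fun x hx => h x hx
  have h2 : ∑ x ∈ S, H.degree x ≤ ∑ x, H.degree x :=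
    Finset.sum_le_sum_of_subset (Finset.subset_univ _)
  rw [H.sum_degrees_eq_twice_card_edges] at h2
  rw [← SimpleGraph.coe_edgeFinset, Set.ncard_coe_finset] at hcard
  omega

/-- A graph on `n + 1` vertices without a `K₅` minor has at most `3 * n` edges. -/
lemma ncard_edgeSet_le_of_not_isGraphMinor (n : ℕ) : ∀ (S : Finset V) (H : SimpleGraph V),
    S.card = n + 1 → (∀ a b, H.Adj a b → a ∈ S) →
    ¬ IsGraphMinor (⊤ : SimpleGraph (Fin 5)) H → H.edgeSet.ncard ≤ 3 * n := by
  classical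
  induction n with
  | zero =>
    intro S H hS hH _
    obtain ⟨x, rfl⟩ := Finset.card_eq_one.1 hS
    have : H = ⊥ := by
      ext a b
      refine ⟨fun h => h.ne ?_, False.elim⟩
      rw [Finset.mem_singleton.1 (hH a b h), Finset.mem_singleton.1 (hH b a h.symm)]
    simp [this]
  | succ n ih =>
    intro S H₀ hS hH₀ hm₀
    by_contra! hlt
    obtain ⟨E, hE, hEcard⟩ := Set.exists_subset_card_eq (s := H₀.edgeSet) (n := 3 * n + 4)
      (by omega)
    obtain ⟨H, hHE, hle⟩ : ∃ H : SimpleGraph V, H.edgeSet = E ∧ H ≤ H₀ := by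
      refine ⟨SimpleGraph.fromEdgeSet E, ?_, ?_⟩
      · rw [SimpleGraph.edgeSet_fromEdgeSet, sdiff_eq_left, Set.disjoint_left]
        exact fun e he => H₀.not_isDiag_of_mem_edgeSet (hE he)
      · intro a b h
        exact hE ((SimpleGraph.fromEdgeSet_adj _).1 h).1
    rw [← hHE] at hEcard
    have hH : ∀ a b, H.Adj a b → a ∈ S := fun a b h => hH₀ a b (hle h)
    have hm : ¬ IsGraphMinor (⊤ : SimpleGraph (Fin 5)) H := fun h => hm₀ (h.mono hle)
    obtain ⟨x, hx, hdeg⟩ := exists_degree_le_five (H := H) (S := S) (by omega)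
    have hcard : (S.erase x).card = n + 1 := by
      rw [Finset.card_erase_of_mem hx]; omega
    have hdel := ih (S.erase x) (H.deleteIncidenceSet x) hcard
      (fun a b h => by
        rw [SimpleGraph.deleteIncidenceSet_adj] at h
        exact Finset.mem_erase.2 ⟨h.2.1, hH a b h.1⟩)
      (fun h => hm (h.mono (H.deleteIncidenceSet_le x)))
    have hdel' := ncard_edgeSet_deleteIncidenceSet H x
    refine hm (IsGraphMinor.completeGraph_five_of_dense_neighborhood (x := x)
      (H.neighborFinset x) (fun y hy => by simpa using hy) ?_ fun y hy => ?_)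
    · rw [SimpleGraph.card_neighborFinset_eq_degree]
      omega
    · rw [SimpleGraph.mem_neighborFinset] at hy
      refine ⟨H.neighborFinset x ∩ H.neighborFinset y, Finset.inter_subset_left,
        fun z hz => by simpa using (Finset.mem_inter.1 hz).2, ?_⟩
      obtain ⟨H', hH', hmin, hcount⟩ := exists_contraction hy
      have := ih (S.erase x) H' hcard
        (fun a b h => by
          obtain ⟨h1, c, h2⟩ := hH' a b h
          exact Finset.mem_erase.2 ⟨h1, hH a c h2⟩)
        (fun h => hm (h.trans hmin))
      omega

open Classical in
/-- A graph on `n` vertices without a `K₅` minor has at most `10 * n` triangles. -/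
lemma card_cliqueFinset_three_le (n : ℕ) : ∀ (S : Finset V) (H : SimpleGraph V),
    S.card = n → (∀ a b, H.Adj a b → a ∈ S) →
    ¬ IsGraphMinor (⊤ : SimpleGraph (Fin 5)) H → (H.cliqueFinset 3).card ≤ 10 * n := by
  induction n with
  | zero =>
    intro S H hS hH _
    rw [Finset.card_eq_zero] at hS
    rw [Nat.le_zero, Finset.card_eq_zero, Finset.eq_empty_iff_forall_notMem]
    intro t ht
    obtain ⟨a, b, c, hab, -⟩ := SimpleGraph.is3Clique_iff.1 ((H.mem_cliqueFinset_iff).1 ht)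
    simpa [hS] using hH a b hab
  | succ n ih =>
    intro S H hS hH hm
    have he := ncard_edgeSet_le_of_not_isGraphMinor n S H hS hH hm
    obtain ⟨x, hx, hdeg⟩ := exists_degree_le_five (H := H) (S := S) (by omega)
    have hdel := ih (S.erase x) (H.deleteIncidenceSet x)
      (by rw [Finset.card_erase_of_mem hx]; omega)
      (fun a b h => by
        rw [SimpleGraph.deleteIncidenceSet_adj] at h
        exact Finset.mem_erase.2 ⟨h.2.1, hH a b h.1⟩)
      (fun h => hm (h.mono (H.deleteIncidenceSet_le x)))
    have hsub : H.cliqueFinset 3 ⊆ (H.deleteIncidenceSet x).cliqueFinset 3 ∪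
        ((H.neighborFinset x).powersetCard 2).image (insert x) := by
      intro t ht
      rw [SimpleGraph.mem_cliqueFinset_iff] at ht
      rw [Finset.mem_union, SimpleGraph.mem_cliqueFinset_iff]
      by_cases hxt : x ∈ t
      · right
        refine Finset.mem_image.2 ⟨t.erase x, Finset.mem_powersetCard.2 ⟨fun y hy => ?_, ?_⟩,
          Finset.insert_erase hxt⟩
        · rw [Finset.mem_erase] at hy
          rw [SimpleGraph.mem_neighborFinset]
          exact ht.isClique hxt hy.2 hy.1.symm
        · rw [Finset.card_erase_of_mem hxt, ht.card_eq]
      · left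
        refine ⟨fun a ha b hb hab => ?_, ht.card_eq⟩
        rw [SimpleGraph.deleteIncidenceSet_adj]
        exact ⟨ht.isClique ha hb hab, fun h => hxt (h ▸ ha), fun h => hxt (h ▸ hb)⟩
    have h1 : ((H.neighborFinset x).powersetCard 2).card ≤ 10 := by
      rw [Finset.card_powersetCard, SimpleGraph.card_neighborFinset_eq_degree]
      exact (Nat.choose_le_choose 2 hdeg).trans (by decide)
    have hdel' : ((H.deleteIncidenceSet x).cliqueFinset 3).card ≤ 10 * n := by convert hdel
    have h2 := (Finset.card_le_card hsub).trans (Finset.card_union_le _ _)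
    have h3 := Finset.card_image_le (s := (H.neighborFinset x).powersetCard 2) (f := insert x)
    omega

end Density

section Counting

variable {V : Type}

lemma ncard_edgeSet_sup_edge [Finite V] {H : SimpleGraph V} {a b : V} (hab : a ≠ b)
    (h : ¬ H.Adj a b) :
    (H ⊔ SimpleGraph.edge a b).edgeSet.ncard = H.edgeSet.ncard + 1 := by
  rw [SimpleGraph.edgeSet_sup, SimpleGraph.edge, SimpleGraph.edgeSet_fromEdgeSet,
    sdiff_eq_left.2 (by simpa using hab), Set.union_singleton,
    Set.ncard_insert_of_notMem (by simpa using h)]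

/-- Contract vertices of an independent set `I` with neighbors in `T` onto neighbors, as long as
each contraction creates a new edge on `T`. In the end the neighborhood of every vertex of `I`
that has not been contracted is a clique. -/
lemma exists_maximal_contraction [Fintype V] [DecidableEq V] (G : SimpleGraph V) (T I : Finset V)
    (hTI : Disjoint T I) (hI : ∀ v ∈ I, ∀ z, G.Adj v z → z ∈ T) :
    ∃ (C : Finset V) (H : SimpleGraph V), IsGraphMinor H G ∧ (∀ a b, H.Adj a b → a ∈ T) ∧
      C.card ≤ H.edgeSet.ncard ∧
      ∀ v ∈ I \ C, ∀ a b, G.Adj v a → G.Adj v b → a ≠ b → H.Adj a b := by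
  classical
  let Q : Finset V → Prop := fun C => C ⊆ I ∧ ∃ (B : V → Set V) (H : SimpleGraph V),
    (∀ t x, x ∈ B t → t ∈ T ∧ (x = t ∨ x ∈ C ∧ G.Adj t x)) ∧ (∀ t ∈ T, t ∈ B t) ∧
    (∀ i j x, x ∈ B i → x ∈ B j → i = j) ∧
    (∀ a b, H.Adj a b → ∃ x ∈ B a, ∃ y ∈ B b, G.Adj x y) ∧ C.card ≤ H.edgeSet.ncard
  have hne : (Finset.univ.filter Q).Nonempty := by
    refine ⟨∅, Finset.mem_filter.2 ⟨Finset.mem_univ _, Finset.empty_subset _,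
      fun t => {x | x = t ∧ t ∈ T}, ⊥, ?_, ?_, ?_, ?_, ?_⟩⟩
    · rintro t x ⟨h, ht⟩
      exact ⟨ht, Or.inl h⟩
    · exact fun t ht => ⟨rfl, ht⟩
    · rintro i j x ⟨rfl, -⟩ ⟨h, -⟩
      exact h
    · exact fun a b h => h.elim
    · simp
  obtain ⟨C, hC, hmax⟩ := Finset.exists_max_image _ Finset.card hne
  obtain ⟨-, hCI, B, H, hB, hself, hdisj, hadj, hcard⟩ := Finset.mem_filter.1 hC
  refine ⟨C, H, ⟨B, ?_, ?_, hadj⟩, ?_, hcard, ?_⟩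
  · intro i j hij
    rw [Set.disjoint_left]
    exact fun x hx hx' => hij (hdisj i j x hx hx')
  · have hreach : ∀ t x (hx : x ∈ B t),
        (G.induce (B t)).Reachable ⟨t, hself t (hB t x hx).1⟩ ⟨x, hx⟩ := by
      intro t x hx
      rcases (hB t x hx).2 with rfl | ⟨-, h⟩
      · rfl
      · exact SimpleGraph.Adj.reachable (by simpa using h)
    rintro t ⟨x, hx⟩ ⟨y, hy⟩
    exact (hreach t x hx).symm.trans (hreach t y hy)
  · intro a b h
    obtain ⟨x, hx, -⟩ := hadj a b h
    exact (hB a x hx).1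
  · intro v hv a b hva hvb hab
    by_contra hnot
    obtain ⟨hvI, hvC⟩ := Finset.mem_sdiff.1 hv
    have haT := hI v hvI a hva
    have hbT := hI v hvI b hvb
    have hvB : ∀ t, v ∉ B t := by
      intro t ht
      obtain ⟨h1, rfl | h2⟩ := hB t v ht
      · exact Finset.disjoint_left.1 hTI h1 hvI
      · exact hvC h2.1
    have hmem : ∀ t x, x ∈ Function.update B a (insert v (B a)) t ↔
        x ∈ B t ∨ t = a ∧ x = v := by
      intro t x
      by_cases h : t = a
      · subst h; simp [or_comm]
      · simp [h]
    have hQ : Q (insert v C) := by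
      refine ⟨Finset.insert_subset hvI hCI, Function.update B a (insert v (B a)),
        H ⊔ SimpleGraph.edge a b, ?_, ?_, ?_, ?_, ?_⟩
      · intro t x hx
        rcases (hmem t x).1 hx with h | ⟨rfl, rfl⟩
        · obtain ⟨h1, h2 | ⟨h2, h3⟩⟩ := hB t x h
          · exact ⟨h1, Or.inl h2⟩
          · exact ⟨h1, Or.inr ⟨Finset.mem_insert_of_mem h2, h3⟩⟩
        · exact ⟨haT, Or.inr ⟨Finset.mem_insert_self _ _, hva.symm⟩⟩
      · exact fun t ht => (hmem t t).2 (Or.inl (hself t ht))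
      · intro i j x hi hj
        rcases (hmem i x).1 hi with h | ⟨h, hv⟩ <;> rcases (hmem j x).1 hj with h' | ⟨h', hv'⟩
        · exact hdisj i j x h h'
        · exact absurd (hv' ▸ h) (hvB i)
        · exact absurd (hv ▸ h') (hvB j)
        · exact h.trans h'.symm
      · rintro c d (h | h)
        · obtain ⟨x, hx, y, hy, hxy⟩ := hadj c d h
          exact ⟨x, (hmem c x).2 (Or.inl hx), y, (hmem d y).2 (Or.inl hy), hxy⟩
        · obtain ⟨⟨rfl, rfl⟩ | ⟨rfl, rfl⟩, -⟩ := (SimpleGraph.edge_adj _ _ _ _).1 h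
          · exact ⟨v, (hmem c v).2 (Or.inr ⟨rfl, rfl⟩), d,
              (hmem d d).2 (Or.inl (hself d hbT)), hvb⟩
          · exact ⟨c, (hmem c c).2 (Or.inl (hself c hbT)), v,
              (hmem d v).2 (Or.inr ⟨rfl, rfl⟩), hvb.symm⟩
      · rw [ncard_edgeSet_sup_edge hab hnot, Finset.card_insert_of_notMem hvC]
        omega
    have := hmax _ (Finset.mem_filter.2 ⟨Finset.mem_univ _, hQ⟩)
    rw [Finset.card_insert_of_notMem hvC] at this
    omega

/-- In a plane graph of minimum degree two without `3`-families, an independent set has at most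
`29` times as many vertices as its neighborhood. -/
lemma card_independent_le [Fintype V] [DecidableEq V] {G : SimpleGraph V} (P : PlaneEmbedding G)
    (hdeg : ∀ v : V, 2 ≤ (G.neighborSet v).ncard) (hfam : ¬ ∃ R : Set V, IsRFamily G R 3)
    (T I : Finset V) (hTI : Disjoint T I) (hI : ∀ v ∈ I, ∀ z, G.Adj v z → z ∈ T) :
    I.card ≤ 29 * T.card := by
  classical
  obtain ⟨C, H, hmin, hHT, hC, hclique⟩ := exists_maximal_contraction G T I hTI hI
  have hm : ¬ IsGraphMinor (⊤ : SimpleGraph (Fin 5)) H :=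
    fun h => P.not_isGraphMinor_completeGraph_five (h.trans hmin)
  have hedges : H.edgeFinset.card ≤ 3 * T.card := by
    rw [← Set.ncard_coe_finset, SimpleGraph.coe_edgeFinset]
    rcases Nat.eq_zero_or_pos T.card with h | h
    · have : H = ⊥ := by
        ext a b
        refine ⟨fun hab => ?_, False.elim⟩
        simpa [Finset.card_eq_zero.1 h] using hHT a b hab
      simp [this]
    · have := ncard_edgeSet_le_of_not_isGraphMinor (T.card - 1) T H (by omega) hHT hm
      omega
  have htri : (H.cliqueFinset 3).card ≤ 10 * T.card := by
    convert card_cliqueFinset_three_le T.card T H rfl hHT hm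
  rw [← SimpleGraph.coe_edgeFinset, Set.ncard_coe_finset] at hC
  set J₂ := (I \ C).filter fun v => (G.neighborSet v).ncard = 2 with hJ₂
  set J₃ := (I \ C).filter fun v => ¬ (G.neighborSet v).ncard = 2 with hJ₃
  have hsplit : J₂.card + J₃.card = (I \ C).card := Finset.card_filter_add_card_filter_not _
  have hIC : I.card ≤ C.card + (I \ C).card := by
    rw [add_comm]
    exact Finset.card_le_card_sdiff_add_card
  have h₂ : J₂.card ≤ 2 * H.edgeFinset.card := by
    have hf : ∀ v, ∃ e : Sym2 V, v ∈ J₂ → e ∈ H.edgeFinset ∧ G.neighborSet v = {z | z ∈ e} := by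
      intro v
      by_cases hv : v ∈ J₂
      · obtain ⟨hvI, hv2⟩ := Finset.mem_filter.1 hv
        obtain ⟨a, b, hab, hN⟩ := Set.ncard_eq_two.1 hv2
        have ha : G.Adj v a := by
          rw [← SimpleGraph.mem_neighborSet, hN]; simp
        have hb : G.Adj v b := by
          rw [← SimpleGraph.mem_neighborSet, hN]; simp
        refine ⟨s(a, b), fun _ => ⟨?_, ?_⟩⟩
        · rw [SimpleGraph.mem_edgeFinset, SimpleGraph.mem_edgeSet]
          exact hclique v hvI a b ha hb hab
        · rw [hN]; ext z; simp
      · exact ⟨s(v, v), fun h => absurd h hv⟩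
    choose f hf using hf
    refine Finset.card_le_mul_card_image_of_maps_to (fun v hv => (hf v hv).1) 2 fun e he => ?_
    by_contra! h
    obtain ⟨R, hR, hR3⟩ := Finset.exists_subset_card_eq (Nat.succ_le_of_lt h)
    apply hfam
    induction e using Sym2.ind with
    | _ a b =>
      refine ⟨R, by rw [Set.ncard_coe_finset, hR3], a, b, ?_, fun v hv => ?_⟩
      · exact (SimpleGraph.mem_edgeFinset.1 he : H.Adj a b).ne
      · obtain ⟨hvJ, hve⟩ := Finset.mem_filter.1 (hR hv)
        rw [(hf v hvJ).2, hve]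
        ext z; simp
  have h₃ : J₃.card ≤ 2 * (H.cliqueFinset 3).card := by
    have hf : ∀ v, ∃ t : Finset V, v ∈ J₃ → t ∈ H.cliqueFinset 3 ∧ ∀ z ∈ t, G.Adj v z := by
      intro v
      by_cases hv : v ∈ J₃
      · obtain ⟨hvI, hv2⟩ := Finset.mem_filter.1 hv
        have h3 : 3 ≤ (G.neighborFinset v).card := by
          rw [← Set.ncard_coe_finset, SimpleGraph.coe_neighborFinset]
          have := hdeg v
          omega
        obtain ⟨t, ht, ht3⟩ := Finset.exists_subset_card_eq h3
        have hta : ∀ z ∈ t, G.Adj v z := fun z hz => by simpa using ht hz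
        refine ⟨t, fun _ => ⟨?_, hta⟩⟩
        rw [SimpleGraph.mem_cliqueFinset_iff]
        exact ⟨fun a ha b hb hab => hclique v hvI a b (hta a ha) (hta b hb) hab, ht3⟩
      · exact ⟨∅, fun h => absurd h hv⟩
    choose f hf using hf
    refine Finset.card_le_mul_card_image_of_maps_to (fun v hv => (hf v hv).1) 2 fun t ht => ?_
    by_contra! h
    obtain ⟨R, hR, hR3⟩ := Finset.exists_subset_card_eq (Nat.succ_le_of_lt h)
    have ht3 : t.card = 3 := ((H.mem_cliqueFinset_iff).1 ht).card_eq
    refine P.false_of_common_neighbors (fun i => ((R.equivFinOfCardEq hR3).symm i : V))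
      (fun i => ((t.equivFinOfCardEq ht3).symm i : V))
      (Subtype.val_injective.comp (Equiv.injective _))
      (Subtype.val_injective.comp (Equiv.injective _)) fun i j => ?_
    obtain ⟨hvJ, hvt⟩ := Finset.mem_filter.1 (hR ((R.equivFinOfCardEq hR3).symm i).2)
    refine (hf _ hvJ).2 _ ?_
    rw [hvt]
    exact Subtype.coe_prop _
  omega

end Counting

section Matching

variable {V : Type}

/-- A finite set of pairwise disjoint edges. -/
def IsEdgeMatching (G : SimpleGraph V) (M : Finset (Sym2 V)) : Prop :=
  (∀ e ∈ M, e ∈ G.edgeSet) ∧ ∀ e ∈ M, ∀ f ∈ M, ∀ v, v ∈ e → v ∈ f → e = f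

lemma IsEdgeMatching.exists_isMatching {G : SimpleGraph V} {M : Finset (Sym2 V)}
    (hM : IsEdgeMatching G M) : ∃ S : G.Subgraph, S.IsMatching ∧ S.edgeSet.ncard = M.card := by
  let S : G.Subgraph :=
    { verts := {v | ∃ e ∈ M, v ∈ e}
      Adj := fun a b => s(a, b) ∈ M
      adj_sub := fun h => hM.1 _ h
      edge_vert := fun h => ⟨_, h, Sym2.mem_mk_left _ _⟩
      symm := ⟨fun a b h => by rwa [Sym2.eq_swap]⟩ }
  refine ⟨S, ?_, ?_⟩
  · rintro v ⟨e, he, hv⟩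
    obtain ⟨w, rfl⟩ := hv
    refine ⟨w, he, fun w' hw' => ?_⟩
    exact Sym2.congr_right.1
      (hM.2 _ hw' _ he v (Sym2.mem_mk_left _ _) (Sym2.mem_mk_left _ _))
  · have : S.edgeSet = (M : Set (Sym2 V)) := by
      ext e
      induction e using Sym2.ind with
      | _ a b => rfl
    rw [this, Set.ncard_coe_finset]

variable [DecidableEq V]

lemma IsEdgeMatching.insert {G : SimpleGraph V} {M : Finset (Sym2 V)} (hM : IsEdgeMatching G M)
    {a b : V} (hab : G.Adj a b) (ha : ∀ e ∈ M, a ∉ e) (hb : ∀ e ∈ M, b ∉ e) :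
    IsEdgeMatching G (insert s(a, b) M) ∧ (insert s(a, b) M).card = M.card + 1 := by
  have hnot : ∀ f ∈ M, ∀ v, v ∈ s(a, b) → v ∉ f := by
    intro f hf v hv
    rcases Sym2.mem_iff.1 hv with rfl | rfl
    · exact ha f hf
    · exact hb f hf
  refine ⟨⟨fun e he => ?_, fun e he f hf v hve hvf => ?_⟩, ?_⟩
  · rcases Finset.mem_insert.1 he with rfl | he
    · exact hab
    · exact hM.1 e he
  · rcases Finset.mem_insert.1 he with rfl | he <;> rcases Finset.mem_insert.1 hf with rfl | hf
    · rfl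
    · exact absurd hvf (hnot f hf v hve)
    · exact absurd hve (hnot e he v hvf)
    · exact hM.2 e he f hf v hve hvf
  · exact Finset.card_insert_of_notMem fun h => ha _ h (Sym2.mem_mk_left _ _)

/-- If the two ends of a matching edge have distinct uncovered neighbors, the matching is not
maximum. -/
lemma IsEdgeMatching.exists_augmentation {G : SimpleGraph V} {M : Finset (Sym2 V)}
    (hM : IsEdgeMatching G M) {u v w w' : V} (huv : s(u, v) ∈ M) (hww : w ≠ w')
    (huw : G.Adj u w) (hvw : G.Adj v w') (hw : ∀ e ∈ M, w ∉ e) (hw' : ∀ e ∈ M, w' ∉ e) :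
    ∃ M', IsEdgeMatching G M' ∧ M.card < M'.card := by
  have hne : u ≠ v := (hM.1 _ huv : G.Adj u v).ne
  have herase : IsEdgeMatching G (M.erase s(u, v)) :=
    ⟨fun e he => hM.1 e (Finset.mem_of_mem_erase he), fun e he f hf =>
      hM.2 e (Finset.mem_of_mem_erase he) f (Finset.mem_of_mem_erase hf)⟩
  have hends : ∀ z, z ∈ s(u, v) → ∀ e ∈ M.erase s(u, v), z ∉ e := by
    intro z hz e he hze
    exact Finset.ne_of_mem_erase he
      (hM.2 e (Finset.mem_of_mem_erase he) _ huv z hze hz)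
  obtain ⟨h₁, hc₁⟩ := herase.insert huw (hends u (Sym2.mem_mk_left _ _))
    (fun e he => hw e (Finset.mem_of_mem_erase he))
  obtain ⟨h₂, hc₂⟩ := h₁.insert hvw
    (fun e he hve => by
      rcases Finset.mem_insert.1 he with rfl | he
      · rcases Sym2.mem_iff.1 hve with h | h
        · exact hne h.symm
        · exact hw _ huv (h ▸ Sym2.mem_mk_right _ _)
      · exact hends v (Sym2.mem_mk_right _ _) e he hve)
    (fun e he hwe => by
      rcases Finset.mem_insert.1 he with rfl | he
      · rcases Sym2.mem_iff.1 hwe with h | h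
        · exact hw' _ huv (h ▸ Sym2.mem_mk_left _ _)
        · exact hww h.symm
      · exact hw' e (Finset.mem_of_mem_erase he) hwe)
  refine ⟨_, h₂, ?_⟩
  have := Finset.card_erase_add_one huv
  omega

/-- A maximum matching with `m` edges leaves uncovered an independent set `I` with neighborhood
in a set `T` of at most `m` vertices, together with at most `m` other vertices. -/
lemma exists_matching_and_independent [Fintype V] (G : SimpleGraph V) :
    ∃ (M : Finset (Sym2 V)) (T I : Finset V), IsEdgeMatching G M ∧ Disjoint T I ∧
      (∀ v ∈ I, ∀ z, G.Adj v z → z ∈ T) ∧ T.card ≤ M.card ∧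
      Fintype.card V ≤ 3 * M.card + I.card := by
  classical
  have hne : (Finset.univ.filter (IsEdgeMatching G)).Nonempty :=
    ⟨∅, Finset.mem_filter.2 ⟨Finset.mem_univ _, by simp [IsEdgeMatching]⟩⟩
  obtain ⟨M, hM, hmax⟩ := Finset.exists_max_image _ Finset.card hne
  replace hM := (Finset.mem_filter.1 hM).2
  replace hmax : ∀ M', IsEdgeMatching G M' → M'.card ≤ M.card := fun M' h =>
    hmax M' (Finset.mem_filter.2 ⟨Finset.mem_univ _, h⟩)
  have hends : ∀ e, ∃ x w, e ∈ M → x ∈ e ∧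
      ∀ v, (∀ f ∈ M, v ∉ f) → ∀ z ∈ e, G.Adj v z → z = x ∨ v = w := by
    intro e
    induction e using Sym2.ind with
    | _ a b =>
      by_cases h : ∃ w, (∀ f ∈ M, w ∉ f) ∧ G.Adj b w
      · obtain ⟨w, hw, hbw⟩ := h
        refine ⟨b, w, fun he => ⟨Sym2.mem_mk_right _ _, fun v hv z hz hvz => ?_⟩⟩
        rcases Sym2.mem_iff.1 hz with rfl | rfl
        · refine Or.inr (by_contra fun hvw => ?_)
          obtain ⟨M', hM', hlt⟩ := hM.exists_augmentation he hvw hvz.symm hbw hv hw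
          exact absurd (hmax M' hM') (not_le.2 hlt)
        · exact Or.inl rfl
      · refine ⟨a, a, fun _ => ⟨Sym2.mem_mk_left _ _, fun v hv z hz hvz => ?_⟩⟩
        rcases Sym2.mem_iff.1 hz with rfl | rfl
        · exact Or.inl rfl
        · exact absurd ⟨v, hv, hvz.symm⟩ h
  choose x w hxw using hends
  let K : Finset V := M.biUnion Sym2.toFinset
  have hK : ∀ v, v ∉ K → ∀ e ∈ M, v ∉ e := fun v hv e he hve =>
    hv (Finset.mem_biUnion.2 ⟨e, he, Sym2.mem_toFinset.2 hve⟩)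
  have hKcard : K.card ≤ M.card * 2 := by
    refine Finset.card_biUnion_le_card_mul _ _ _ fun e _ => ?_
    rw [Sym2.card_toFinset]
    split_ifs <;> omega
  refine ⟨M, M.image x, (K ∪ M.image w)ᶜ, hM, ?_, ?_, Finset.card_image_le, ?_⟩
  · refine Finset.disjoint_left.2 fun v hv hv' => ?_
    obtain ⟨e, he, rfl⟩ := Finset.mem_image.1 hv
    simp only [Finset.mem_compl, Finset.mem_union, not_or] at hv'
    exact hK _ hv'.1 e he (hxw e he).1
  · intro v hv z hvz
    simp only [Finset.mem_compl, Finset.mem_union, not_or] at hv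
    obtain ⟨hvK, hvW⟩ := hv
    by_cases hz : ∃ e ∈ M, z ∈ e
    · obtain ⟨e, he, hze⟩ := hz
      rcases (hxw e he).2 v (hK v hvK) z hze hvz with rfl | rfl
      · exact Finset.mem_image_of_mem _ he
      · exact absurd (Finset.mem_image_of_mem _ he) hvW
    · obtain ⟨h₁, h₂⟩ := hM.insert hvz (hK v hvK) fun e he hze => hz ⟨e, he, hze⟩
      have := hmax _ h₁
      omega
  · have h₁ : (M.image w).card ≤ M.card := Finset.card_image_le
    have h₂ := Finset.card_union_le K (M.image w)
    have h₃ := Finset.card_add_card_compl (K ∪ M.image w)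
    omega

end Matching

/-- A connected planar graph on `n` vertices with minimum degree 2
and no 3-family has a matching of size at least `n/33`. -/
theorem matching_of_no_three_family {V : Type} [Fintype V] (G : SimpleGraph V)
    (hconn : G.Connected) (hplanar : Nonempty (PlaneEmbedding G))
    (hdeg : ∀ v : V, 2 ≤ (G.neighborSet v).ncard)
    (hfam : ¬ ∃ R : Set V, IsRFamily G R 3) :
    ∃ M : G.Subgraph, M.IsMatching ∧
      Fintype.card V ≤ 33 * M.edgeSet.ncard := by
  classical
  obtain ⟨P⟩ := hplanar
  obtain ⟨M, T, I, hM, hTI, hI, hT, hcard⟩ := exists_matching_and_independent G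
  obtain ⟨S, hS, hSM⟩ := hM.exists_isMatching
  have := card_independent_le P hdeg hfam T I hTI hI
  exact ⟨S, hS, by omega⟩
end
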